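/- arXiv:0807.1081 — 2 statements merged into one kernel-verified Lean document; each statement's English description precedes it below -/
import Mathlib

section
/- The function u(τ) = (πi/2)·ℰ₄(τ), where ℰ₄ := (𝒞₄⁴)′/𝒞₄⁴, satisfies the generalized Chazy equation u₄u₈ − u₆² + 8u₄³ = 0 on the upper half-plane; likewise the function u(τ) = πi·ℰ₂(τ), where ℰ₂ := (θ₂⁴)′/θ₂⁴, satisfies u₄u₈ − u₆² + 8u₄³ = 0 on the upper half-plane. -/
open Complex

noncomputable section

/-- q = exp(2πiτ). -/
def qq (τ : ℂ) : ℂ := Complex.exp (2 * Real.pi * Complex.I * τ)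

/-- The Dedekind eta function η(τ) = exp(πiτ/12)·∏_{n≥1} (1 − qⁿ). -/
def dedekindEta (τ : ℂ) : ℂ :=
  Complex.exp (Real.pi * Complex.I * τ / 12) * ∏' n : ℕ, (1 - qq τ ^ (n + 1))

/-- The Jacobi theta-null θ₂. -/
def theta2 (τ : ℂ) : ℂ :=
  ∑' m : ℤ, Complex.exp (2 * Real.pi * Complex.I * τ * ((m : ℂ) + 1 / 2) ^ 2)

/-- 𝒞₄⁴(τ) = 64·η(2τ)¹⁶/η(τ)⁸. -/
def C44 (τ : ℂ) : ℂ := 64 * dedekindEta (2 * τ) ^ 16 / dedekindEta τ ^ 8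

/-- The derivation f ↦ f′ = (2πi)⁻¹ df/dτ = q d/dq. -/
def dq (f : ℂ → ℂ) : ℂ → ℂ := fun τ => (2 * Real.pi * Complex.I)⁻¹ * deriv f τ

/-- ℰ₄ := (𝒞₄⁴)′/𝒞₄⁴. -/
def E4sig : ℂ → ℂ := fun τ => dq C44 τ / C44 τ

/-- ℰ₂ := (θ₂⁴)′/θ₂⁴. -/
def E2sig : ℂ → ℂ := fun τ => dq (fun t => theta2 t ^ 4) τ / theta2 τ ^ 4

/-- u₄ = u̇ − u². -/
def chazyU4 (u : ℂ → ℂ) (τ : ℂ) : ℂ := deriv u τ - u τ ^ 2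

/-- u₆ = ü − 6uu̇ + 4u³. -/
def chazyU6 (u : ℂ → ℂ) (τ : ℂ) : ℂ :=
  deriv (deriv u) τ - 6 * u τ * deriv u τ + 4 * u τ ^ 3

/-- u₈ = u⃛ − 12uü − 6u̇² + 48u²u̇ − 24u⁴. -/
def chazyU8 (u : ℂ → ℂ) (τ : ℂ) : ℂ :=
  deriv (deriv (deriv u)) τ - 12 * u τ * deriv (deriv u) τ - 6 * (deriv u τ) ^ 2 +
    48 * u τ ^ 2 * deriv u τ - 24 * u τ ^ 4


open UpperHalfPlane Filter Topology

/-- The filter of neighbourhoods of i∞ in the complex plane. -/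
abbrev atI : Filter ℂ := comap Complex.im atTop

section LevelOne

open ModularForm MatrixGroups OnePoint Asymptotics CongruenceSubgroup ModularGroup

lemma slash_eq_of {k : ℤ} {F : ℂ → ℂ}
    (hT : ∀ z : ℂ, 0 < z.im → F (z + 1) = F z)
    (hS : ∀ z : ℂ, 0 < z.im → F (-1 / z) = z ^ k * F z) (γ : SL(2, ℤ)) :
    (fun z : ℍ => F z) ∣[k] γ = fun z : ℍ => F z := by
  refine SlashInvariantForm.slash_action_generators_SL2Z ?_ ?_ γ
  · ext z
    rw [SL_slash_apply, UpperHalfPlane.modular_S_smul]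
    have h0 : (z : ℂ) ≠ 0 := ne_zero z
    have := hS z z.2
    change F ((-(z : ℂ))⁻¹) * _ = F z
    rw [show (-(z:ℂ))⁻¹ = -1 / z by rw [inv_neg]; ring, this]
    have hd : denom (ModularGroup.S : SL(2, ℤ)) z = z := by
      rw [ModularGroup.denom_apply]; simp [ModularGroup.S]
    rw [hd, zpow_neg]
    field_simp
  · ext z
    rw [SL_slash_apply, UpperHalfPlane.modular_T_smul]
    have := hT z z.2
    have hd : denom (ModularGroup.T : SL(2, ℤ)) z = 1 := by
      rw [ModularGroup.denom_apply]; simp [ModularGroup.T]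
    rw [hd, one_zpow, mul_one, UpperHalfPlane.coe_vadd]
    rw [add_comm]; exact_mod_cast this

/-- The cusp form attached to a function with the level one transformation laws. -/
def mkCusp (k : ℤ) (F : ℂ → ℂ) (hd : DifferentiableOn ℂ F {z | 0 < z.im})
    (hT : ∀ z : ℂ, 0 < z.im → F (z + 1) = F z)
    (hS : ∀ z : ℂ, 0 < z.im → F (-1 / z) = z ^ k * F z)
    (hI : Tendsto F atI (𝓝 0)) : CuspForm 𝒮ℒ k where
  toFun := fun z : ℍ => F z
  slash_action_eq' A hA := by
    obtain ⟨A, rfl⟩ := hA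
    exact slash_eq_of hT hS A
  holo' := by
    rw [UpperHalfPlane.mdifferentiable_iff]
    refine hd.congr fun z hz ↦ ?_
    simp only [Function.comp]
    rw [ofComplex_apply_of_im_pos hz]
    rfl
  zero_at_cusps' hc := by
    rw [Subgroup.IsArithmetic.isCusp_iff_isCusp_SL2Z] at hc
    rw [OnePoint.isZeroAt_iff_forall_SL2Z hc]
    intro γ _
    rw [slash_eq_of hT hS γ]
    exact hI.comp tendsto_coe_atImInfty

lemma levelOne_zero (k : ℤ) (hk : k < 12) (F : ℂ → ℂ) (hd : DifferentiableOn ℂ F {z | 0 < z.im})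
    (hT : ∀ z : ℂ, 0 < z.im → F (z + 1) = F z)
    (hS : ∀ z : ℂ, 0 < z.im → F (-1 / z) = z ^ k * F z)
    (hI : Tendsto F atI (𝓝 0)) (z : ℂ) (hz : 0 < z.im) : F z = 0 := by
  have h : mkCusp k F hd hT hS hI = 0 :=
    rank_zero_iff_forall_zero.mp (CuspForm.rank_eq_zero_of_weight_lt_twelve hk) _
  exact DFunLike.congr_fun h (⟨z, hz⟩ : ℍ)

lemma levelOne_zero12 (F : ℂ → ℂ) (hd : DifferentiableOn ℂ F {z | 0 < z.im})
    (hT : ∀ z : ℂ, 0 < z.im → F (z + 1) = F z)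
    (hS : ∀ z : ℂ, 0 < z.im → F (-1 / z) = z ^ (12 : ℤ) * F z)
    (hI : F =o[atI] (fun z => Real.exp (-2 * Real.pi * z.im)))
    (z : ℂ) (hz : 0 < z.im) : F z = 0 := by
  have hI0 : Tendsto F atI (𝓝 0) := by
    refine hI.isBigO.trans_tendsto ?_
    refine Real.tendsto_exp_atBot.comp ?_
    have : Tendsto (fun z : ℂ => z.im) atI atTop := tendsto_comap
    exact this.const_mul_atTop_of_neg (by have := Real.pi_pos; linarith)
  obtain ⟨c, hc⟩ := CuspForm.exists_smul_discriminant_of_weight_eq_twelve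
    (mkCusp 12 F hd hT hS hI0)
  have hF : ∀ z : ℍ, F z = c * ModularForm.discriminant z := fun z =>
    (DFunLike.congr_fun hc z).symm
  have h1 : (fun z : ℍ => F z) =o[atImInfty] ModularForm.discriminant :=
    (hI.comp_tendsto tendsto_coe_atImInfty).trans_isBigO exp_isBigO_discriminant
  have h2 : c = 0 := by
    by_contra hc0
    have h3 : (fun z : ℍ => ModularForm.discriminant z) =o[atImInfty] ModularForm.discriminant := by
      have := h1.const_mul_left c⁻¹
      refine this.congr_left fun z => ?_
      rw [hF]; field_simp
    have h4 := h3.def (c := 1/2) (by norm_num)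
    obtain ⟨w, hw⟩ := h4.exists
    have := norm_pos_iff.mpr (ModularForm.discriminant_ne_zero w)
    linarith
  rw [hF ⟨z, hz⟩, h2, zero_mul]

end LevelOne

section Eisenstein

open ModularForm MatrixGroups EisensteinSeries

/-- Eisenstein series of weight 2 as a function on ℂ. -/
def eP (z : ℂ) : ℂ := EisensteinSeries.E2 (ofComplex z)
/-- Eisenstein series of weight 4 as a function on ℂ. -/
def eQ (z : ℂ) : ℂ := (E₄ : ℍ → ℂ) (ofComplex z)
/-- Eisenstein series of weight 6 as a function on ℂ. -/
def eR (z : ℂ) : ℂ := (E₆ : ℍ → ℂ) (ofComplex z)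

lemma eP_diff : DifferentiableOn ℂ eP {z | 0 < z.im} :=
  UpperHalfPlane.mdifferentiable_iff.mp E2_mdifferentiable
lemma eQ_diff : DifferentiableOn ℂ eQ {z | 0 < z.im} :=
  UpperHalfPlane.mdifferentiable_iff.mp E₄.holo'
lemma eR_diff : DifferentiableOn ℂ eR {z | 0 < z.im} :=
  UpperHalfPlane.mdifferentiable_iff.mp E₆.holo'

lemma neg_inv_im {z : ℂ} (hz : 0 < z.im) : 0 < (-1 / z).im := by
  have := im_inv_neg_coe_pos ⟨z, hz⟩
  rwa [show (-1 / z) = (-z)⁻¹ by rw [inv_neg]; ring]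

lemma slash_S (f : ℍ → ℂ) (k : ℤ) (z : ℂ) (hz : 0 < z.im) :
    (f ∣[k] ModularGroup.S) (ofComplex z) = f (ofComplex (-1 / z)) * z ^ (-k) := by
  rw [SL_slash_apply, UpperHalfPlane.modular_S_smul]
  have hd : denom (ModularGroup.S : SL(2, ℤ)) (ofComplex z) = z := by
    rw [ModularGroup.denom_apply]; simp [ModularGroup.S, ofComplex_apply_of_im_pos hz]
  rw [hd, ofComplex_apply_of_im_pos (neg_inv_im hz)]
  congr 2
  ext
  simp [ofComplex_apply_of_im_pos hz]
  ring

lemma slash_T (f : ℍ → ℂ) (k : ℤ) (z : ℂ) (hz : 0 < z.im) :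
    (f ∣[k] ModularGroup.T) (ofComplex z) = f (ofComplex (z + 1)) := by
  rw [SL_slash_apply, UpperHalfPlane.modular_T_smul]
  have hd : denom (ModularGroup.T : SL(2, ℤ)) (ofComplex z) = 1 := by
    rw [ModularGroup.denom_apply]; simp [ModularGroup.T]
  rw [hd, one_zpow, mul_one, ofComplex_apply_of_im_pos (z := z + 1) (by simpa using hz)]
  congr 1
  ext
  simp [ofComplex_apply_of_im_pos hz, add_comm]

lemma eP_T (z : ℂ) (hz : 0 < z.im) : eP (z + 1) = eP z := by
  unfold eP
  rw [← slash_T EisensteinSeries.E2 2 z hz, E2_slash_action, D2_T]; simp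
lemma eQ_T (z : ℂ) (hz : 0 < z.im) : eQ (z + 1) = eQ z := by
  unfold eQ
  rw [← slash_T E₄ 4 z hz]
  exact congrFun (E₄.slash_action_eq' _ ⟨ModularGroup.T, rfl⟩) _
lemma eR_T (z : ℂ) (hz : 0 < z.im) : eR (z + 1) = eR z := by
  unfold eR
  rw [← slash_T E₆ 6 z hz]
  exact congrFun (E₆.slash_action_eq' _ ⟨ModularGroup.T, rfl⟩) _

lemma ne_zero_of_im {z : ℂ} (hz : 0 < z.im) : z ≠ 0 := by
  rintro rfl; simp at hz

lemma eQ_S (z : ℂ) (hz : 0 < z.im) : eQ (-1 / z) = z ^ 4 * eQ z := by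
  have h := slash_S E₄ 4 z hz
  have h2 : ((E₄ : ℍ → ℂ) ∣[(4 : ℤ)] ModularGroup.S) (ofComplex z) = E₄ (ofComplex z) :=
    congrFun (E₄.slash_action_eq' _ ⟨ModularGroup.S, rfl⟩) _
  have h0 := ne_zero_of_im hz
  rw [h2, zpow_neg] at h
  unfold eQ
  rw [h]
  norm_cast
  field_simp
lemma eR_S (z : ℂ) (hz : 0 < z.im) : eR (-1 / z) = z ^ 6 * eR z := by
  have h := slash_S E₆ 6 z hz
  have h2 : ((E₆ : ℍ → ℂ) ∣[(6 : ℤ)] ModularGroup.S) (ofComplex z) = E₆ (ofComplex z) :=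
    congrFun (E₆.slash_action_eq' _ ⟨ModularGroup.S, rfl⟩) _
  have h0 := ne_zero_of_im hz
  rw [h2, zpow_neg] at h
  unfold eR
  rw [h]
  norm_cast
  field_simp

lemma pi_I_ne : (Real.pi : ℂ) * Complex.I ≠ 0 := by
  simp [Real.pi_ne_zero]

lemma eP_S (z : ℂ) (hz : 0 < z.im) : eP (-1 / z) = z ^ 2 * eP z + 6 * z / (Real.pi * Complex.I) := by
  have h := slash_S EisensteinSeries.E2 2 z hz
  have h0 := ne_zero_of_im hz
  have hp : (Real.pi : ℂ) ≠ 0 := by simp [Real.pi_ne_zero]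
  have hd : denom (ModularGroup.S : SL(2, ℤ)) (ofComplex z) = z := by
    rw [ModularGroup.denom_apply]; simp [ModularGroup.S, ofComplex_apply_of_im_pos hz]
  rw [E2_slash_action, zpow_neg, Pi.sub_apply, Pi.smul_apply, D2, hd, riemannZeta_two] at h
  unfold eP
  generalize EisensteinSeries.E2 (ofComplex (-1 / z)) = a at h ⊢
  generalize EisensteinSeries.E2 (ofComplex z) = b at h ⊢
  simp [ModularGroup.S] at h
  have h3 : a = z ^ 2 * (a * (z ^ 2)⁻¹) := by
    field_simp
  rw [h3, ← h]
  field_simp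
  linear_combination (-6 : ℂ) * Complex.I_sq

lemma tendsto_of_hasSum {f : ℍ → ℂ} {c : ℕ → ℂ}
    (hf : ∀ τ : ℍ, HasSum (fun m ↦ c m • Function.Periodic.qParam 1 τ ^ m) (f τ)) :
    Tendsto f atImInfty (𝓝 (c 0)) := by
  have hq : Tendsto (fun τ : ℍ => Function.Periodic.qParam 1 τ) atImInfty (𝓝 0) :=
    UpperHalfPlane.qParam_tendsto_atImInfty one_pos
  have hq0 : Function.Periodic.qParam 1 UpperHalfPlane.I ≠ 0 := Function.Periodic.qParam_ne_zero _
  have key : Tendsto (fun τ : ℍ => ∑' m, c m • Function.Periodic.qParam 1 τ ^ m) atImInfty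
      (𝓝 (∑' m, if m = 0 then c 0 else 0)) := by
    refine tendsto_tsum_of_dominated_convergence
      (bound := fun m => ‖c m • Function.Periodic.qParam 1 UpperHalfPlane.I ^ m‖)
      (hf UpperHalfPlane.I).summable.norm ?_ ?_
    · intro m
      by_cases hm : m = 0
      · subst hm; simp
      · simp only [hm, if_false]
        have := (hq.pow m).const_smul (c m)
        simpa [hm] using this
    · have := hq.norm.eventually_lt_const (u := ‖Function.Periodic.qParam 1 UpperHalfPlane.I‖)
        (by simpa using hq0)
      filter_upwards [this] with τ hτ m
      rw [norm_smul, norm_smul, norm_pow, norm_pow]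
      gcongr
  rw [tsum_ite_eq] at key
  exact key.congr fun τ => (hf τ).tsum_eq

lemma eP_I : Tendsto eP atI (𝓝 1) := by
  have := tendsto_of_hasSum (f := EisensteinSeries.E2)
    (c := fun m => (if m = 0 then 1 else -24 * ArithmeticFunction.sigma 1 m : ℂ)) (fun τ => by
      simpa only [Function.Periodic.qParam, ofReal_one, div_one] using hasSum_qExpansion_E2 (z := τ))
  exact this.comp tendsto_comap_im_ofComplex

lemma mf_I {k : ℤ} (f : ModularForm 𝒮ℒ k) :
    Tendsto (fun z => f (ofComplex z)) atI (𝓝 ((qExpansion 1 f).coeff 0)) := by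
  have := tendsto_of_hasSum (f := f) (c := fun m => (qExpansion 1 f).coeff m)
    (fun τ => UpperHalfPlane.hasSum_qExpansion one_pos
      (SlashInvariantFormClass.periodic_comp_ofComplex f one_mem_strictPeriods_SL)
      f.holo' (ModularFormClass.bdd_at_infty f) τ)
  exact this.comp tendsto_comap_im_ofComplex

lemma eQ_I : Tendsto eQ atI (𝓝 1) := by
  have := mf_I E₄
  rwa [E_qExpansion_coeff_zero _ ⟨2, rfl⟩] at this
lemma eR_I : Tendsto eR atI (𝓝 1) := by
  have := mf_I E₆
  rwa [E_qExpansion_coeff_zero _ ⟨3, rfl⟩] at this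

end Eisenstein
section Ramanujan

lemma isOpen_H : IsOpen {z : ℂ | 0 < z.im} := isOpen_lt continuous_const Complex.continuous_im

lemma eventually_H {z : ℂ} (hz : 0 < z.im) : ∀ᶠ w in 𝓝 z, 0 < w.im := isOpen_H.mem_nhds hz

lemma hasDerivAt_of_H {f : ℂ → ℂ} (hf : DifferentiableOn ℂ f {z | 0 < z.im}) {z : ℂ}
    (hz : 0 < z.im) : HasDerivAt f (deriv f z) z :=
  (hf.differentiableAt (isOpen_H.mem_nhds hz)).hasDerivAt

lemma deriv_diffOn {f : ℂ → ℂ} (hf : DifferentiableOn ℂ f {z | 0 < z.im}) :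
    DifferentiableOn ℂ (deriv f) {z | 0 < z.im} := hf.deriv isOpen_H

lemma dq_diffOn {f : ℂ → ℂ} (hf : DifferentiableOn ℂ f {z | 0 < z.im}) :
    DifferentiableOn ℂ (dq f) {z | 0 < z.im} := (deriv_diffOn hf).const_mul _

lemma atI_mem (M : ℝ) : ∀ᶠ z : ℂ in atI, M < z.im :=
  tendsto_comap.eventually (eventually_gt_atTop M)

lemma atI_exists {p : ℂ → Prop} (h : ∀ᶠ z in atI, p z) : ∃ M : ℝ, ∀ z : ℂ, M ≤ z.im → p z := by
  obtain ⟨s, hs, h⟩ := eventually_comap.mp h |>.exists_mem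
  obtain ⟨M, hM⟩ := mem_atTop_sets.mp hs
  exact ⟨M, fun z hz => h _ (hM _ hz) z rfl⟩

lemma deriv_tendsto_zero {f : ℂ → ℂ} {c : ℂ} (hf : DifferentiableOn ℂ f {z | 0 < z.im})
    (hI : Tendsto f atI (𝓝 c)) : Tendsto (deriv f) atI (𝓝 0) := by
  rw [Metric.tendsto_nhds]
  intro ε hε
  obtain ⟨M, hM⟩ := atI_exists (Metric.tendsto_nhds.mp hI (ε / 2) (by positivity))
  filter_upwards [atI_mem (max M 0 + 1)] with z hz
  have him : ∀ w ∈ Metric.closedBall z 1, max M 0 < w.im := by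
    intro w hw
    have h1 := (Complex.abs_im_le_norm (w - z)).trans (by simpa [dist_eq_norm] using hw)
    rw [abs_le, Complex.sub_im] at h1
    linarith
  have hd : DifferentiableOn ℂ (fun w => f w - c) (Metric.closedBall z 1) :=
    (hf.mono fun w hw => lt_of_le_of_lt (le_max_right _ _) (him w hw)).sub_const c
  have := Complex.norm_deriv_le_of_forall_mem_sphere_norm_le (f := fun w => f w - c) (c := z)
    (R := 1) (C := ε / 2) one_pos
    (DifferentiableOn.diffContOnCl (by rwa [closure_ball _ one_ne_zero])) (fun w hw => by
      have := hM w ((le_max_left _ _).trans (him w (Metric.sphere_subset_closedBall hw)).le)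
      rw [dist_eq_norm] at this; exact this.le)
  rw [deriv_sub_const] at this
  rw [dist_zero_right]
  linarith

lemma dq_tendsto_zero {f : ℂ → ℂ} {c : ℂ} (hf : DifferentiableOn ℂ f {z | 0 < z.im})
    (hI : Tendsto f atI (𝓝 c)) : Tendsto (dq f) atI (𝓝 0) := by
  have := (deriv_tendsto_zero hf hI).const_mul (2 * Real.pi * Complex.I)⁻¹
  rwa [mul_zero] at this

lemma dq_T {f : ℂ → ℂ} (hT : ∀ z : ℂ, 0 < z.im → f (z + 1) = f z) (z : ℂ) (hz : 0 < z.im) :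
    dq f (z + 1) = dq f z := by
  unfold dq
  rw [← deriv_comp_add_const]
  congr 1
  refine Filter.EventuallyEq.deriv_eq ?_
  filter_upwards [eventually_H hz] with w hw using hT w hw

lemma dq_S {f g : ℂ → ℂ} (hf : DifferentiableOn ℂ f {z | 0 < z.im}) {z g' : ℂ} (hz : 0 < z.im)
    (hg : HasDerivAt g g' z) (hS : ∀ w : ℂ, 0 < w.im → f (-1 / w) = g w) :
    dq f (-1 / z) = (2 * Real.pi * Complex.I)⁻¹ * (z ^ 2 * g') := by
  have h0 := ne_zero_of_im hz
  have h1 := hasDerivAt_of_H hf (neg_inv_im hz)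
  have h2 : HasDerivAt (fun w : ℂ => -1 / w) (1 / z ^ 2) z := by
    have := (hasDerivAt_inv h0).const_mul (-1)
    refine (this.congr_deriv ?_).congr_of_eventuallyEq (.of_forall fun w => ?_)
    · field_simp
    · simp only [div_eq_mul_inv]
  have h3 := HasDerivAt.comp z h1 h2
  have h4 : HasDerivAt (f ∘ fun w : ℂ => -1 / w) g' z :=
    hg.congr_of_eventuallyEq (by filter_upwards [eventually_H hz] with w hw using hS w hw)
  have := h3.unique h4
  unfold dq
  rw [← this]
  field_simp

lemma ram1 (z : ℂ) (hz : 0 < z.im) : dq eP z = (eP z ^ 2 - eQ z) / 12 := by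
  have := levelOne_zero 4 (by norm_num) (fun z => dq eP z - (eP z ^ 2 - eQ z) / 12)
    ((dq_diffOn eP_diff).sub (((eP_diff.pow 2).sub eQ_diff).div_const 12))
    (fun z hz => by simp only [dq_T eP_T z hz, eP_T z hz, eQ_T z hz])
    (fun z hz => by
      have h0 := ne_zero_of_im hz
      have hp := pi_I_ne
      have hp' : (Real.pi : ℂ) ≠ 0 := by simp [Real.pi_ne_zero]
      have hI : Complex.I ≠ 0 := Complex.I_ne_zero
      have hd := hasDerivAt_of_H eP_diff hz
      have hg := ((hasDerivAt_pow 2 z).mul hd).add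
        (((hasDerivAt_id z).const_mul 6).div_const (Real.pi * Complex.I))
      simp only [dq_S eP_diff hz hg eP_S]
      rw [eP_S z hz, eQ_S z hz, zpow_ofNat]
      unfold dq
      field_simp
      ring)
    (by
      have := (dq_tendsto_zero eP_diff eP_I).sub (((eP_I.pow 2).sub eQ_I).div_const 12)
      simpa using this) z hz
  linear_combination this

lemma ram2 (z : ℂ) (hz : 0 < z.im) : dq eQ z = (eP z * eQ z - eR z) / 3 := by
  have := levelOne_zero 6 (by norm_num) (fun z => dq eQ z - (eP z * eQ z - eR z) / 3)
    ((dq_diffOn eQ_diff).sub (((eP_diff.mul eQ_diff).sub eR_diff).div_const 3))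
    (fun z hz => by simp only [dq_T eQ_T z hz, eP_T z hz, eQ_T z hz, eR_T z hz])
    (fun z hz => by
      have h0 := ne_zero_of_im hz
      have hp' : (Real.pi : ℂ) ≠ 0 := by simp [Real.pi_ne_zero]
      have hI : Complex.I ≠ 0 := Complex.I_ne_zero
      have hd := hasDerivAt_of_H eQ_diff hz
      have hg := ((hasDerivAt_pow 4 z).mul hd)
      simp only [dq_S eQ_diff hz hg eQ_S]
      rw [eP_S z hz, eQ_S z hz, eR_S z hz, zpow_ofNat]
      unfold dq
      field_simp
      ring)
    (by
      have := (dq_tendsto_zero eQ_diff eQ_I).sub (((eP_I.mul eQ_I).sub eR_I).div_const 3)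
      simpa using this) z hz
  linear_combination this

lemma ram3 (z : ℂ) (hz : 0 < z.im) : dq eR z = (eP z * eR z - eQ z ^ 2) / 2 := by
  have := levelOne_zero 8 (by norm_num) (fun z => dq eR z - (eP z * eR z - eQ z ^ 2) / 2)
    ((dq_diffOn eR_diff).sub (((eP_diff.mul eR_diff).sub (eQ_diff.pow 2)).div_const 2))
    (fun z hz => by simp only [dq_T eR_T z hz, eP_T z hz, eQ_T z hz, eR_T z hz])
    (fun z hz => by
      have h0 := ne_zero_of_im hz
      have hp' : (Real.pi : ℂ) ≠ 0 := by simp [Real.pi_ne_zero]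
      have hI : Complex.I ≠ 0 := Complex.I_ne_zero
      have hd := hasDerivAt_of_H eR_diff hz
      have hg := ((hasDerivAt_pow 6 z).mul hd)
      simp only [dq_S eR_diff hz hg eR_S]
      rw [eP_S z hz, eQ_S z hz, eR_S z hz, zpow_ofNat]
      unfold dq
      field_simp
      ring)
    (by
      have := (dq_tendsto_zero eR_diff eR_I).sub (((eP_I.mul eR_I).sub (eQ_I.pow 2)).div_const 2)
      simpa using this) z hz
  linear_combination this

end Ramanujan

section KeyIdentity

open Asymptotics

/-- The level two weight two Eisenstein series. -/
def eA (z : ℂ) : ℂ := 2 * eP (2 * z) - eP z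

/-- The auxiliary level two weight four form, to be shown to vanish. -/
def eF (z : ℂ) : ℂ := 5 * eA z ^ 2 - 4 * eQ (2 * z) - eQ z

lemma two_im {z : ℂ} (hz : 0 < z.im) : 0 < (2 * z).im := by simpa using hz
lemma half_im {z : ℂ} (hz : 0 < z.im) : 0 < (z / 2).im := by simpa using hz
lemma half_im' {z : ℂ} (hz : 0 < z.im) : 0 < ((z + 1) / 2).im := by simpa using hz

lemma comp_two_diff {f : ℂ → ℂ} (hf : DifferentiableOn ℂ f {z | 0 < z.im}) :
    DifferentiableOn ℂ (fun z => f (2 * z)) {z | 0 < z.im} :=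
  hf.comp (by fun_prop) (fun z hz => two_im hz)
lemma comp_half_diff {f : ℂ → ℂ} (hf : DifferentiableOn ℂ f {z | 0 < z.im}) :
    DifferentiableOn ℂ (fun z => f (z / 2)) {z | 0 < z.im} :=
  hf.comp (by fun_prop) (fun z hz => half_im hz)
lemma comp_half_diff' {f : ℂ → ℂ} (hf : DifferentiableOn ℂ f {z | 0 < z.im}) :
    DifferentiableOn ℂ (fun z => f ((z + 1) / 2)) {z | 0 < z.im} :=
  hf.comp (by fun_prop) (fun z hz => half_im' hz)

lemma eA_diff : DifferentiableOn ℂ eA {z | 0 < z.im} :=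
  ((comp_two_diff eP_diff).const_mul 2).sub eP_diff
lemma eF_diff : DifferentiableOn ℂ eF {z | 0 < z.im} :=
  (((eA_diff.pow 2).const_mul 5).sub ((comp_two_diff eQ_diff).const_mul 4)).sub eQ_diff

lemma two_T {f : ℂ → ℂ} (hT : ∀ z : ℂ, 0 < z.im → f (z + 1) = f z) (z : ℂ) (hz : 0 < z.im) :
    f (2 * (z + 1)) = f (2 * z) := by
  rw [show 2 * (z + 1) = (2 * z + 1) + 1 by ring, hT _ (by simpa using hz), hT _ (two_im hz)]

lemma eF_T (z : ℂ) (hz : 0 < z.im) : eF (z + 1) = eF z := by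
  unfold eF eA
  rw [two_T eP_T z hz, two_T eQ_T z hz, eP_T z hz, eQ_T z hz]

lemma eF_W (z : ℂ) (hz : 0 < z.im) : eF (-1 / (2 * z)) = 4 * z ^ 4 * eF z := by
  have h0 := ne_zero_of_im hz
  have h2 : 2 * (-1 / (2 * z)) = -1 / z := by field_simp
  unfold eF eA
  rw [h2, eP_S z hz, eQ_S z hz, eP_S _ (two_im hz), eQ_S _ (two_im hz)]
  ring

lemma tendsto_two : Tendsto (fun z : ℂ => 2 * z) atI atI := by
  rw [tendsto_comap_iff]
  have : Tendsto (fun z : ℂ => 2 * z.im) atI atTop := tendsto_comap.const_mul_atTop two_pos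
  refine this.congr fun z => by simp
lemma tendsto_half : Tendsto (fun z : ℂ => z / 2) atI atI := by
  rw [tendsto_comap_iff]
  have : Tendsto (fun z : ℂ => z.im / 2) atI atTop := tendsto_comap.atTop_div_const two_pos
  refine this.congr fun z => by simp
lemma tendsto_half' : Tendsto (fun z : ℂ => (z + 1) / 2) atI atI := by
  rw [tendsto_comap_iff]
  have : Tendsto (fun z : ℂ => z.im / 2) atI atTop := tendsto_comap.atTop_div_const two_pos
  refine this.congr fun z => by simp

lemma eA_I : Tendsto eA atI (𝓝 1) := by
  have := ((eP_I.comp tendsto_two).const_mul 2).sub eP_I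
  norm_num at this
  exact this

lemma eF_I : Tendsto eF atI (𝓝 0) := by
  have := (((eA_I.pow 2).const_mul 5).sub ((eQ_I.comp tendsto_two).const_mul 4)).sub eQ_I
  norm_num at this
  exact this

lemma eF_decay : eF =O[atI] (fun z => Real.exp (-2 * Real.pi * z.im)) := by
  have hz0 : IsZeroAtImInfty (fun z : ℍ => eF z) := eF_I.comp tendsto_coe_atImInfty
  have h := hz0.exp_decay_atImInfty one_pos ?_ ?_ (hz0.isBoundedAtImInfty)
  · have := h.comp_tendsto tendsto_comap_im_ofComplex
    refine this.congr' ?_ ?_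
    · filter_upwards [atI_mem 0] with z hz
      simp [ofComplex_apply_of_im_pos hz]
    · filter_upwards [atI_mem 0] with z hz
      simp [ofComplex_apply_of_im_pos hz]
  · intro z
    by_cases hz : 0 < z.im
    · have h1 : 0 < (z + 1).im := by simpa using hz
      simp only [Function.comp, Complex.ofReal_one]
      rw [ofComplex_apply_of_im_pos hz, ofComplex_apply_of_im_pos h1]
      exact eF_T z hz
    · have h1 : (z + 1).im ≤ 0 := by simpa using hz
      simp only [Function.comp, Complex.ofReal_one]
      rw [ofComplex_apply_of_im_nonpos (not_lt.mp hz), ofComplex_apply_of_im_nonpos h1]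
  · rw [UpperHalfPlane.mdifferentiable_iff]
    refine eF_diff.congr fun z hz ↦ ?_
    simp only [Function.comp]
    rw [ofComplex_apply_of_im_pos hz]

lemma eF_mid (z : ℂ) (hz : 0 < z.im) : eF ((-1 / z + 1) / 2) = z ^ 4 * eF ((z + 1) / 2) := by
  have h0 := ne_zero_of_im hz
  have hz1 : 0 < (z - 1).im := by simpa using hz
  have h1 := ne_zero_of_im hz1
  have hv : 0 < ((-1 / z + 1) / 2).im := half_im' (neg_inv_im hz)
  have e1 := eF_W _ hv
  have e2 := eF_W _ (half_im hz1)
  have e3 := eF_T _ (half_im hz1)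
  rw [show (z - 1) / 2 + 1 = (z + 1) / 2 by ring] at e3
  have e4 := eF_T (-1 / (2 * ((-1 / z + 1) / 2)))
    (neg_inv_im (two_im hv))
  have h5 : -1 / (2 * ((-1 / z + 1) / 2)) + 1 = -1 / (2 * ((z - 1) / 2)) := by
    have : (-1 / z + 1) = (z - 1) / z := by field_simp; ring
    rw [this]
    field_simp
    ring
  rw [h5, e2, e1, ← e3] at e4
  have h6 : (-1 / z + 1) / 2 = (z - 1) / (2 * z) := by field_simp; ring
  rw [h6] at e4 ⊢
  field_simp at e4
  have h7 : (z - 1) ^ 4 ≠ 0 := pow_ne_zero _ h1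
  rw [mul_comm 2 z]
  exact e4.symm

lemma isPreconnected_H : IsPreconnected {z : ℂ | 0 < z.im} :=
  (convex_halfSpace_im_gt 0).isPreconnected

lemma mul_zero_H {f g : ℂ → ℂ} (hf : DifferentiableOn ℂ f {z | 0 < z.im})
    (hg : DifferentiableOn ℂ g {z | 0 < z.im}) (h : ∀ z : ℂ, 0 < z.im → f z * g z = 0) :
    (∀ z : ℂ, 0 < z.im → f z = 0) ∨ (∀ z : ℂ, 0 < z.im → g z = 0) :=
  (hf.analyticOnNhd isOpen_H).eq_zero_or_eq_zero_of_mul_eq_zero (hg.analyticOnNhd isOpen_H)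
    h isPreconnected_H

lemma eF_zero (z : ℂ) (hz : 0 < z.im) : eF z = 0 := by
  have h1 : ∀ z : ℂ, 0 < z.im → eF z * (eF (z / 2) * eF ((z + 1) / 2)) = 0 := by
    refine levelOne_zero12 (fun z => eF z * (eF (z / 2) * eF ((z + 1) / 2)))
      (eF_diff.mul ((comp_half_diff eF_diff).mul (comp_half_diff' eF_diff))) ?_ ?_ ?_
    · intro z hz
      have := eF_T _ (half_im hz)
      rw [show z / 2 + 1 = (z + 1 + 1) / 2 by ring] at this
      rw [this, eF_T z hz]; ring
    · intro z hz
      have h0 := ne_zero_of_im hz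
      rw [eF_mid z hz]
      have e1 := eF_W _ (half_im hz)
      have e2 := eF_W _ hz
      rw [show 2 * (z / 2) = z by ring] at e1
      rw [show -1 / z / 2 = -1 / (2 * z) by field_simp, e1, e2, zpow_ofNat]
      ring
    · have h2 := (eF_I.comp tendsto_half).mul (eF_I.comp tendsto_half')
      rw [mul_zero] at h2
      have := eF_decay.mul_isLittleO ((isLittleO_one_iff ℝ).mpr h2)
      simp only [mul_one] at this
      exact this
  rcases mul_zero_H eF_diff ((comp_half_diff eF_diff).mul (comp_half_diff' eF_diff)) h1 with h | h
  · exact h z hz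
  · rcases mul_zero_H (comp_half_diff eF_diff) (comp_half_diff' eF_diff) h with h | h
    · have := h (2 * z) (two_im hz)
      simpa using this
    · have := h (2 * z - 1) (by simpa using hz)
      simpa using this

end KeyIdentity

section Chazy

lemma hasDerivAt_dq {f : ℂ → ℂ} (hf : DifferentiableOn ℂ f {z | 0 < z.im}) {z d : ℂ}
    (hz : 0 < z.im) (h : dq f z = d) :
    HasDerivAt f (2 * Real.pi * Complex.I * d) z := by
  refine (hasDerivAt_of_H hf hz).congr_deriv ?_
  have hp := Complex.two_pi_I_ne_zero
  rw [← h]; unfold dq; field_simp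

lemma hasDerivAt_two {f : ℂ → ℂ} {z d : ℂ} (h : HasDerivAt f d (2 * z)) :
    HasDerivAt (fun t => f (2 * t)) (2 * d) z := by
  have := h.comp z ((hasDerivAt_id z).const_mul 2)
  refine this.congr_deriv (by ring)

lemma deriv_id_zero {f : ℂ → ℂ} {z d : ℂ} (hz : 0 < z.im) (h : ∀ z : ℂ, 0 < z.im → f z = 0)
    (hd : HasDerivAt f d z) : d = 0 := by
  have : HasDerivAt f 0 z := (hasDerivAt_const z (0 : ℂ)).congr_of_eventuallyEq (by
    filter_upwards [eventually_H hz] with w hw using h w hw)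
  exact hd.unique this

section
variable {z : ℂ}
lemma dP (hz : 0 < z.im) : HasDerivAt eP (2 * Real.pi * Complex.I * ((eP z ^ 2 - eQ z) / 12)) z :=
  hasDerivAt_dq eP_diff hz (ram1 z hz)
lemma dQ (hz : 0 < z.im) :
    HasDerivAt eQ (2 * Real.pi * Complex.I * ((eP z * eQ z - eR z) / 3)) z :=
  hasDerivAt_dq eQ_diff hz (ram2 z hz)
lemma dR (hz : 0 < z.im) :
    HasDerivAt eR (2 * Real.pi * Complex.I * ((eP z * eR z - eQ z ^ 2) / 2)) z :=
  hasDerivAt_dq eR_diff hz (ram3 z hz)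

lemma dA (hz : 0 < z.im) :
    HasDerivAt eA (2 * Real.pi * Complex.I *
      ((eP (2 * z) ^ 2 - eQ (2 * z)) / 3 - (eP z ^ 2 - eQ z) / 12)) z := by
  have := ((hasDerivAt_two (dP (two_im hz))).const_mul 2).sub (dP hz)
  exact this.congr_deriv (by ring)

lemma id1 (z : ℂ) (hz : 0 < z.im) : 5 * eA z ^ 2 - 4 * eQ (2 * z) - eQ z = 0 := eF_zero z hz

lemma id2 (z : ℂ) (hz : 0 < z.im) :
    8 * eR (2 * z) + eR z - eA z * (12 * eQ (2 * z) - 3 * eQ z) = 0 := by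
  have h1 := id1 z hz
  have hd := ((((dA hz).pow 2).const_mul 5).sub ((hasDerivAt_two (dQ (two_im hz))).const_mul 4)).sub
    (dQ hz)
  have h2 := deriv_id_zero hz id1 hd
  have hX : (2 * Real.pi * Complex.I) * (10 * eA z *
      ((eP (2 * z) ^ 2 - eQ (2 * z)) / 3 - (eP z ^ 2 - eQ z) / 12)
      - 8 * ((eP (2 * z) * eQ (2 * z) - eR (2 * z)) / 3) - (eP z * eQ z - eR z) / 3) = 0 := by
    rw [← h2]; push_cast; ring
  have hY := (mul_eq_zero.mp hX).resolve_left Complex.two_pi_I_ne_zero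
  unfold eA at *
  linear_combination 3 * hY - (2 * eP (2 * z) - (2 * eP (2 * z) - eP z) / 2) * h1

lemma id3 (z : ℂ) (hz : 0 < z.im) :
    eA z * (16 * eR (2 * z) - 3 * eR z - eA z * (8 * eQ (2 * z) + 5 * eQ z)) = 0 := by
  have h1 := id1 z hz
  have h2 := id2 z hz
  have hd := (((hasDerivAt_two (dR (two_im hz))).const_mul 8).add (dR hz)).sub
    ((dA hz).mul (((hasDerivAt_two (dQ (two_im hz))).const_mul 12).sub ((dQ hz).const_mul 3)))
  have h3 := deriv_id_zero hz id2 hd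
  have hX : (2 * Real.pi * Complex.I) * (8 * (eP (2 * z) * eR (2 * z) - eQ (2 * z) ^ 2)
      + (eP z * eR z - eQ z ^ 2) / 2
      - ((eP (2 * z) ^ 2 - eQ (2 * z)) / 3 - (eP z ^ 2 - eQ z) / 12) * (12 * eQ (2 * z) - 3 * eQ z)
      - eA z * (8 * (eP (2 * z) * eQ (2 * z) - eR (2 * z)) - (eP z * eQ z - eR z))) = 0 := by
    rw [← h3]; simp only [Pi.sub_apply]; ring
  have hY := (mul_eq_zero.mp hX).resolve_left Complex.two_pi_I_ne_zero
  unfold eA at *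
  linear_combination 2 * hY - 2 * eP (2 * z) * h2 - (4 * eQ (2 * z) + eQ z) / 2 * h1

lemma id4 (z : ℂ) (hz : 0 < z.im) :
    16 * eR (2 * z) - 3 * eR z - eA z * (8 * eQ (2 * z) + 5 * eQ z) = 0 := by
  have hd : DifferentiableOn ℂ (fun z => 16 * eR (2 * z) - 3 * eR z -
      eA z * (8 * eQ (2 * z) + 5 * eQ z)) {z | 0 < z.im} :=
    (((comp_two_diff eR_diff).const_mul 16).sub (eR_diff.const_mul 3)).sub
      (eA_diff.mul (((comp_two_diff eQ_diff).const_mul 8).add (eQ_diff.const_mul 5)))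
  rcases mul_zero_H eA_diff hd id3 with h | h
  · exfalso
    have : Tendsto eA atI (𝓝 0) := by
      refine tendsto_const_nhds.congr' ?_
      filter_upwards [atI_mem 0] with z hz using (h z hz).symm
    have hne : (atI).NeBot := by
      refine comap_neBot fun t ht => ?_
      obtain ⟨a, ha⟩ := mem_atTop_sets.mp ht
      exact ⟨⟨0, a⟩, ha a le_rfl⟩
    exact one_ne_zero (tendsto_nhds_unique eA_I this)
  · exact h z hz

/-- Logarithmic derivative function. -/
def eE (z : ℂ) : ℂ := (4 * eP (2 * z) - eP z) / 3
/-- The weight four form controlling `u₄`. -/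
def eB (z : ℂ) : ℂ := (16 * eQ (2 * z) - eQ z) / 15

lemma dE (z : ℂ) (hz : 0 < z.im) :
    HasDerivAt eE (Real.pi * Complex.I / 2 * (eE z ^ 2 - eB z)) z := by
  have := (((hasDerivAt_two (dP (two_im hz))).const_mul 4).sub (dP hz)).div_const 3
  refine this.congr_deriv ?_
  have h1 := id1 z hz
  unfold eE eB eA at *
  linear_combination (-(Real.pi : ℂ) * Complex.I / 45) * h1

lemma dA' (z : ℂ) (hz : 0 < z.im) :
    HasDerivAt eA (2 * (Real.pi * Complex.I / 2) * (eE z * eA z - eB z)) z := by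
  refine (dA hz).congr_deriv ?_
  have h1 := id1 z hz
  unfold eE eB eA at *
  linear_combination (-(Real.pi : ℂ) * Complex.I / 10) * h1

lemma dB (z : ℂ) (hz : 0 < z.im) :
    HasDerivAt eB (4 * (Real.pi * Complex.I / 2) * ((eE z - eA z) * eB z)) z := by
  have := (((hasDerivAt_two (dQ (two_im hz))).const_mul 16).sub (dQ hz)).div_const 15
  refine this.congr_deriv ?_
  have h1 := id1 z hz
  have h2 := id2 z hz
  have h4 := id4 z hz
  unfold eE eB eA at *
  linear_combination (2 * (Real.pi : ℂ) * Complex.I / 45) * (-2 * h2 - h4)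
end

lemma chazy_of {c : ℂ} {E A B u : ℂ → ℂ}
    (hE : ∀ z : ℂ, 0 < z.im → HasDerivAt E (c * (E z ^ 2 - B z)) z)
    (hA : ∀ z : ℂ, 0 < z.im → HasDerivAt A (2 * c * (E z * A z - B z)) z)
    (hB : ∀ z : ℂ, 0 < z.im → HasDerivAt B (4 * c * ((E z - A z) * B z)) z)
    (hu : ∀ z : ℂ, 0 < z.im → u z = c * E z) (z : ℂ) (hz : 0 < z.im) :
    chazyU4 u z * chazyU8 u z - chazyU6 u z ^ 2 + 8 * chazyU4 u z ^ 3 = 0 := by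
  have step : ∀ {f g h : ℂ → ℂ}, (∀ z : ℂ, 0 < z.im → f z = g z) →
      (∀ z : ℂ, 0 < z.im → HasDerivAt g (h z) z) → ∀ z : ℂ, 0 < z.im → deriv f z = h z := by
    intro f g h h1 h2 z hz
    rw [← (h2 z hz).deriv]
    refine Filter.EventuallyEq.deriv_eq ?_
    filter_upwards [eventually_H hz] with w hw using h1 w hw
  have d1 := step (h := fun z => c ^ 2 * (E z ^ 2 - B z)) hu
    (fun z hz => ((hE z hz).const_mul c).congr_deriv (by ring))
  have d2 := step (h := fun z => c ^ 3 * (2 * E z ^ 3 - 6 * E z * B z + 4 * A z * B z)) d1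
    (fun z hz => ((((hE z hz).pow 2).sub (hB z hz)).const_mul (c ^ 2)).congr_deriv
      (by push_cast; ring))
  have d3 := step (h := fun z => c ^ 4 * ((6 * E z ^ 2 - 6 * B z) * (E z ^ 2 - B z)
      + (4 * A z - 6 * E z) * (4 * (E z - A z) * B z) + 8 * B z * (E z * A z - B z))) d2
    (fun z hz => ((((((hE z hz).pow 3).const_mul 2).sub
      (((hE z hz).const_mul 6).mul (hB z hz))).add
      (((hA z hz).const_mul 4).mul (hB z hz))).const_mul (c ^ 3)).congr_deriv
      (by push_cast; ring))
  unfold chazyU4 chazyU6 chazyU8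
  rw [d1 z hz, d2 z hz, d3 z hz, hu z hz]
  ring

lemma chazy_one {u : ℂ → ℂ}
    (hu : ∀ z : ℂ, 0 < z.im → u z = Real.pi * Complex.I / 2 * eE z) (z : ℂ) (hz : 0 < z.im) :
    chazyU4 u z * chazyU8 u z - chazyU6 u z ^ 2 + 8 * chazyU4 u z ^ 3 = 0 :=
  chazy_of dE dA' dB hu z hz

lemma chazy_two {u : ℂ → ℂ}
    (hu : ∀ z : ℂ, 0 < z.im → u z = Real.pi * Complex.I * eE (2 * z)) (z : ℂ) (hz : 0 < z.im) :
    chazyU4 u z * chazyU8 u z - chazyU6 u z ^ 2 + 8 * chazyU4 u z ^ 3 = 0 :=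
  chazy_of (c := Real.pi * Complex.I) (E := fun z => eE (2 * z)) (A := fun z => eA (2 * z))
    (B := fun z => eB (2 * z))
    (fun z hz => (hasDerivAt_two (dE _ (two_im hz))).congr_deriv (by ring))
    (fun z hz => (hasDerivAt_two (dA' _ (two_im hz))).congr_deriv (by ring))
    (fun z hz => (hasDerivAt_two (dB _ (two_im hz))).congr_deriv (by ring)) hu z hz

end Chazy

section Shanks

/-- Partial products in the formula of Gauss. -/
def gP (x : ℂ) (n : ℕ) : ℂ :=
  ∏ i ∈ Finset.range n, (1 - x ^ (2 * i + 2)) / (1 - x ^ (2 * i + 1))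

lemma one_sub_pow_ne {x : ℂ} (hx : ‖x‖ < 1) (n : ℕ) : 1 - x ^ (n + 1) ≠ 0 := by
  intro h
  have h1 : ‖x ^ (n + 1)‖ < 1 := by
    rw [norm_pow]; exact pow_lt_one₀ (norm_nonneg _) hx (by omega)
  rw [← sub_eq_zero.mp h] at h1
  simp at h1

lemma gP_ne {x : ℂ} (hx : ‖x‖ < 1) (n : ℕ) : gP x n ≠ 0 :=
  Finset.prod_ne_zero_iff.mpr fun i _ =>
    div_ne_zero (one_sub_pow_ne hx (2 * i + 1)) (one_sub_pow_ne hx (2 * i))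

lemma gP_succ (x : ℂ) (n : ℕ) :
    gP x (n + 1) = gP x n * ((1 - x ^ (2 * n + 2)) / (1 - x ^ (2 * n + 1))) :=
  Finset.prod_range_succ _ _

lemma shanks_aux {x : ℂ} (hx : ‖x‖ < 1) (n m : ℕ) :
    ∑ s ∈ Finset.range m, (gP x (n + 1) / gP x s * x ^ (s * (2 * n + 3)) -
      gP x n / gP x s * x ^ (s * (2 * n + 1))) =
    gP x n / gP x m * x ^ (m * (2 * n + 1)) * (1 - x ^ (2 * m)) / (1 - x ^ (2 * n + 1)) := by
  have h1 := one_sub_pow_ne hx (2 * n)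
  induction m with
  | zero => simp
  | succ m ih =>
    rw [Finset.sum_range_succ, ih, gP_succ, gP_succ]
    have h2 := one_sub_pow_ne hx (2 * m)
    have h3 := one_sub_pow_ne hx (2 * m + 1)
    have h4 := gP_ne hx m
    have h5 := gP_ne hx n
    rw [show 2 * m + 1 + 1 = 2 * m + 2 by ring] at h3
    rw [show 2 * (m + 1) = 2 * m + 2 by ring]
    rw [show x ^ (m * (2 * n + 3)) = x ^ (m * (2 * n + 1)) * x ^ (2 * m) by rw [← pow_add]; congr 1; ring,
      show x ^ ((m + 1) * (2 * n + 1)) = x ^ (m * (2 * n + 1)) * x ^ (2 * n + 1) by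
        rw [← pow_add]; congr 1; ring]
    generalize x ^ (m * (2 * n + 1)) = X
    field_simp
    ring

lemma shanks {x : ℂ} (hx : ‖x‖ < 1) (n : ℕ) :
    ∑ s ∈ Finset.range (2 * n), x ^ (s * (s + 1) / 2) =
    ∑ s ∈ Finset.range n, gP x n / gP x s * x ^ (s * (2 * n + 1)) := by
  induction n with
  | zero => simp
  | succ n ih =>
    have h := shanks_aux hx n n
    rw [Finset.sum_sub_distrib, ← ih] at h
    have h1 := one_sub_pow_ne hx (2 * n)
    have h5 := gP_ne hx n
    rw [show 2 * (n + 1) = 2 * n + 1 + 1 by ring, Finset.sum_range_succ, Finset.sum_range_succ,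
      Finset.sum_range_succ _ n, show 2 * n + 1 + 1 + 1 = 2 * n + 3 by ring,
      sub_eq_iff_eq_add.mp h, gP_succ, div_self h5,
      show 2 * n * (2 * n + 1) / 2 = n * (2 * n + 1) by
        rw [mul_assoc, Nat.mul_div_cancel_left _ two_pos],
      show (2 * n + 1) * (2 * n + 1 + 1) / 2 = n * (2 * n + 1) + (2 * n + 1) by
        rw [show (2 * n + 1) * (2 * n + 1 + 1) = 2 * (n * (2 * n + 1) + (2 * n + 1)) by ring,
          Nat.mul_div_cancel_left _ two_pos],
      show n * (2 * n + 3) = n * (2 * n + 1) + 2 * n by ring, pow_add _ (n * (2 * n + 1)),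
      pow_add _ (n * (2 * n + 1))]
    generalize x ^ (n * (2 * n + 1)) = X
    field_simp
    ring

lemma gP_prod {x : ℂ} (hx : ‖x‖ < 1) (n : ℕ) :
    gP x n * ∏ i ∈ Finset.range (2 * n), (1 - x ^ (i + 1)) =
      (∏ i ∈ Finset.range n, (1 - (x ^ 2) ^ (i + 1))) ^ 2 := by
  induction n with
  | zero => simp [gP]
  | succ n ih =>
    have h1 := one_sub_pow_ne hx (2 * n)
    rw [show 2 * (n + 1) = 2 * n + 1 + 1 by ring, Finset.prod_range_succ, Finset.prod_range_succ,
      Finset.prod_range_succ, mul_pow, ← ih, gP_succ, ← pow_mul]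
    field_simp
    ring_nf

/-- The Euler product. -/
def ePhi (x : ℂ) : ℂ := ∏' n : ℕ, (1 - x ^ (n + 1))

lemma ePhi_tendsto {x : ℂ} (hx : ‖x‖ < 1) :
    Tendsto (fun n => ∏ i ∈ Finset.range n, (1 - x ^ (i + 1))) atTop (𝓝 (ePhi x)) :=
  (ModularForm.multipliable_one_sub_pow hx).tendsto_prod_tprod_nat

lemma gP_tendsto {x : ℂ} (hx : ‖x‖ < 1) (h0 : ePhi x ≠ 0) :
    Tendsto (gP x) atTop (𝓝 (ePhi (x ^ 2) ^ 2 / ePhi x)) := by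
  have hx2 : ‖x ^ 2‖ < 1 := by rw [norm_pow]; exact pow_lt_one₀ (norm_nonneg _) hx two_ne_zero
  have h2 : Tendsto (fun n : ℕ => 2 * n) atTop atTop := tendsto_id.const_mul_atTop' two_pos
  have := ((ePhi_tendsto hx2).pow 2).div ((ePhi_tendsto hx).comp h2) h0
  refine this.congr fun n => ?_
  simp only [Pi.div_apply, Function.comp]
  rw [← gP_prod hx]
  refine mul_div_cancel_right₀ _ ?_
  exact Finset.prod_ne_zero_iff.mpr fun i _ => one_sub_pow_ne hx i

lemma summable_psi {x : ℂ} (hx : ‖x‖ < 1) : Summable (fun s : ℕ => x ^ (s * (s + 1) / 2)) := by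
  refine Summable.of_norm_bounded (summable_geometric_of_lt_one (norm_nonneg x) hx) fun s => ?_
  rw [norm_pow]
  refine pow_le_pow_of_le_one (norm_nonneg _) hx.le ?_
  rw [Nat.le_div_iff_mul_le two_pos]
  nlinarith [Nat.zero_le s, Nat.le_mul_self s]

lemma gauss {x : ℂ} (hx : ‖x‖ < 1) (h0 : ePhi x ≠ 0) (h02 : ePhi (x ^ 2) ≠ 0) :
    ∑' s : ℕ, x ^ (s * (s + 1) / 2) = ePhi (x ^ 2) ^ 2 / ePhi x := by
  have hP := gP_tendsto hx h0
  have hL : ePhi (x ^ 2) ^ 2 / ePhi x ≠ 0 := div_ne_zero (pow_ne_zero _ h02) h0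
  have hP' := hP.inv₀ hL
  obtain ⟨K, hK⟩ := (Metric.isBounded_range_of_tendsto _ hP).exists_norm_le
  obtain ⟨K', hK'⟩ := (Metric.isBounded_range_of_tendsto _ hP').exists_norm_le
  have hK : ∀ n, ‖gP x n‖ ≤ K := fun n => hK _ ⟨n, rfl⟩
  have hK' : ∀ n, ‖(gP x n)⁻¹‖ ≤ K' := fun n => hK' _ ⟨n, rfl⟩
  have hK0 : 0 ≤ K := (norm_nonneg _).trans (hK 0)
  have hK0' : 0 ≤ K' := (norm_nonneg _).trans (hK' 0)
  have key : Tendsto (fun n : ℕ => ∑' s : ℕ, if s < n then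
      gP x n / gP x s * x ^ (s * (2 * n + 1)) else 0) atTop
      (𝓝 (∑' s : ℕ, if s = 0 then ePhi (x ^ 2) ^ 2 / ePhi x else 0)) := by
    refine tendsto_tsum_of_dominated_convergence (bound := fun s => K * K' * ‖x‖ ^ s)
      ((summable_geometric_of_lt_one (norm_nonneg x) hx).mul_left _) ?_ ?_
    · intro s
      have : Tendsto (fun n : ℕ => gP x n / gP x s * x ^ (s * (2 * n + 1))) atTop
          (𝓝 (if s = 0 then ePhi (x ^ 2) ^ 2 / ePhi x else 0)) := by
        by_cases hs : s = 0
        · subst hs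
          have h1 : gP x 0 = 1 := by simp [gP]
          simpa [h1] using hP
        · have hlim : Tendsto (fun n : ℕ => x ^ (s * (2 * n + 1))) atTop (𝓝 0) := by
            refine (tendsto_pow_atTop_nhds_zero_of_norm_lt_one hx).comp ?_
            refine tendsto_atTop_mono (fun n => ?_) tendsto_id
            have : 1 ≤ s := Nat.one_le_iff_ne_zero.mpr hs
            simp only [id]
            nlinarith
          have := (hP.div_const (gP x s)).mul hlim
          simpa [hs] using this
      refine this.congr' ?_
      filter_upwards [eventually_gt_atTop s] with n hn
      simp [hn]
    · refine Eventually.of_forall fun n s => ?_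
      split_ifs
      · rw [norm_mul, div_eq_mul_inv, norm_mul, norm_pow]
        gcongr ?_ * ?_ * ?_
        · exact hK n
        · exact hK' s
        · exact pow_le_pow_of_le_one (norm_nonneg _) hx.le (by nlinarith [Nat.zero_le (s * n)])
      · simp only [norm_zero]; positivity
  rw [tsum_ite_eq] at key
  have h2 : Tendsto (fun n : ℕ => 2 * n) atTop atTop := tendsto_id.const_mul_atTop' two_pos
  have hl := (summable_psi hx).hasSum.tendsto_sum_nat.comp h2
  refine tendsto_nhds_unique hl (key.congr fun n => ?_)
  simp only [Function.comp]
  rw [shanks hx n, tsum_eq_sum (s := Finset.range n)]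
  · exact Finset.sum_congr rfl fun s hs => by simp [Finset.mem_range.mp hs]
  · intro s hs
    simp only [Finset.mem_range] at hs
    simp [hs]

end Shanks

section Identification

lemma dedekindEta_eq : dedekindEta = ModularForm.eta := by
  ext z
  unfold dedekindEta ModularForm.eta qq
  simp only [ModularForm.eta_q_eq_pow]
  congr 1
  unfold Function.Periodic.qParam
  congr 1
  push_cast
  ring

lemma eta_ne {z : ℂ} (hz : 0 < z.im) : dedekindEta z ≠ 0 := by
  rw [dedekindEta_eq]; exact ModularForm.eta_ne_zero hz

lemma eta_deriv {z : ℂ} (hz : 0 < z.im) :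
    HasDerivAt dedekindEta (Real.pi * Complex.I / 12 * eP z * dedekindEta z) z := by
  have h1 := eta_ne hz
  rw [dedekindEta_eq] at *
  have hd := (ModularForm.differentiableAt_eta_of_mem_upperHalfPlaneSet hz).hasDerivAt
  refine hd.congr_deriv ?_
  have h := ModularForm.logDeriv_eta_eq_E2 ⟨z, hz⟩
  rw [logDeriv_apply] at h
  unfold eP
  rw [ofComplex_apply_of_im_pos hz, ← h]
  field_simp

lemma E4sig_eq (z : ℂ) (hz : 0 < z.im) : E4sig z = eE z := by
  have h1 := eta_ne hz
  have h2 := eta_ne (two_im hz)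
  have hd := ((((hasDerivAt_two (eta_deriv (two_im hz))).pow 16).const_mul 64).div
    ((eta_deriv hz).pow 8) (pow_ne_zero _ h1)).deriv
  have hp' : (Real.pi : ℂ) ≠ 0 := by simp [Real.pi_ne_zero]
  have hI : Complex.I ≠ 0 := Complex.I_ne_zero
  unfold E4sig dq
  change (2 * Real.pi * Complex.I)⁻¹ * deriv C44 z / C44 z = _
  have hC : deriv C44 z = _ := hd
  rw [hC]
  unfold C44 eE
  simp only [Pi.pow_apply]
  field_simp
  ring

lemma ePhi_qq_ne {z : ℂ} (hz : 0 < z.im) : ePhi (qq z) ≠ 0 := by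
  have := eta_ne hz
  exact right_ne_zero_of_mul this

lemma qq_norm {z : ℂ} (hz : 0 < z.im) : ‖qq z‖ < 1 :=
  UpperHalfPlane.norm_exp_two_pi_I_lt_one ⟨z, hz⟩

lemma theta2_eq (z : ℂ) (hz : 0 < z.im) :
    theta2 z = 2 * dedekindEta (2 * (2 * z)) ^ 2 / dedekindEta (2 * z) := by
  have hx := qq_norm (two_im hz)
  have hx2 : qq (2 * z) ^ 2 = qq (2 * (2 * z)) := by
    unfold qq; rw [← Complex.exp_nat_mul]; congr 1; push_cast; ring
  have hg := gauss hx (ePhi_qq_ne (two_im hz)) (by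
    rw [hx2]; exact ePhi_qq_ne (two_im (two_im hz)))
  have hs := ((summable_psi hx).hasSum).mul_left (Complex.exp (Real.pi * Complex.I * z / 2))
  rw [hg] at hs
  have hterm : ∀ n : ℕ, Complex.exp (2 * Real.pi * Complex.I * z * ((n : ℂ) + 1 / 2) ^ 2) =
      Complex.exp (Real.pi * Complex.I * z / 2) * qq (2 * z) ^ (n * (n + 1) / 2) := by
    intro n
    unfold qq
    rw [← Complex.exp_nat_mul, ← Complex.exp_add]
    congr 1
    rw [Nat.cast_div (Nat.even_mul_succ_self n).two_dvd (by norm_num)]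
    push_cast
    ring
  have h1 : HasSum (fun n : ℕ => Complex.exp (2 * Real.pi * Complex.I * z *
      (((n : ℤ) : ℂ) + 1 / 2) ^ 2)) (Complex.exp (Real.pi * Complex.I * z / 2) *
        (ePhi (qq (2 * z) ^ 2) ^ 2 / ePhi (qq (2 * z)))) := by
    refine (congrArg (HasSum · _) (funext fun n => ?_)).mpr hs
    rw [← hterm n, Int.cast_natCast]
  have h2 : HasSum (fun n : ℕ => Complex.exp (2 * Real.pi * Complex.I * z *
      (((-((n : ℤ) + 1) : ℤ) : ℂ) + 1 / 2) ^ 2)) (Complex.exp (Real.pi * Complex.I * z / 2) *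
        (ePhi (qq (2 * z) ^ 2) ^ 2 / ePhi (qq (2 * z)))) := by
    refine (congrArg (HasSum · _) (funext fun n => ?_)).mpr hs
    rw [← hterm n]
    congr 1
    push_cast
    ring
  have h3 := (HasSum.of_nat_of_neg_add_one (f := fun m : ℤ =>
    Complex.exp (2 * Real.pi * Complex.I * z * ((m : ℂ) + 1 / 2) ^ 2)) h1 h2).tsum_eq
  unfold theta2
  rw [h3]
  unfold dedekindEta
  change _ = 2 * (Complex.exp _ * ePhi (qq (2 * (2 * z)))) ^ 2 /
    (Complex.exp _ * ePhi (qq (2 * z)))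
  rw [← hx2, mul_pow, ← Complex.exp_nat_mul]
  have he : Complex.exp (((2 : ℕ) : ℂ) * (Real.pi * Complex.I * (2 * (2 * z)) / 12)) =
      Complex.exp (Real.pi * Complex.I * z / 2) *
        Complex.exp (Real.pi * Complex.I * (2 * z) / 12) := by
    rw [← Complex.exp_add]; congr 1; push_cast; ring
  rw [he]
  have h5 := Complex.exp_ne_zero (Real.pi * Complex.I * (2 * z) / 12)
  have h6 := ePhi_qq_ne (two_im hz)
  field_simp
  ring

lemma E2sig_eq (z : ℂ) (hz : 0 < z.im) : E2sig z = eE (2 * z) := by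
  have h1 := eta_ne (two_im hz)
  have h2 := eta_ne (two_im (two_im hz))
  have hd := ((((((hasDerivAt_two (hasDerivAt_two (f := dedekindEta)
    (eta_deriv (two_im (two_im hz)))))).pow 2).const_mul 2).div
    (hasDerivAt_two (eta_deriv (two_im hz))) h1).pow 4).deriv
  have hp' : (Real.pi : ℂ) ≠ 0 := by simp [Real.pi_ne_zero]
  have hI : Complex.I ≠ 0 := Complex.I_ne_zero
  unfold E2sig dq
  have hC : deriv (fun t => theta2 t ^ 4) z =
      deriv (fun t => (2 * dedekindEta (2 * (2 * t)) ^ 2 / dedekindEta (2 * t)) ^ 4) z := by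
    refine Filter.EventuallyEq.deriv_eq ?_
    filter_upwards [eventually_H hz] with w hw
    rw [theta2_eq w hw]
  have hC' := hC.trans hd
  rw [hC', theta2_eq z hz]
  unfold eE
  simp only [Pi.pow_apply, Pi.div_apply]
  generalize dedekindEta (2 * (2 * z)) = a at h2 ⊢
  generalize dedekindEta (2 * z) = b at h1 ⊢
  generalize eP (2 * (2 * z)) = c
  generalize eP (2 * z) = d
  norm_num
  field_simp
  linear_combination (12 * d - 48 * c) * Complex.I_sq

end Identification

theorem generalized_chazy_signature4_and_signature2 (τ : ℂ) (hτ : 0 < τ.im) :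
    (chazyU4 (fun t => (Real.pi : ℂ) * Complex.I / 2 * E4sig t) τ *
        chazyU8 (fun t => (Real.pi : ℂ) * Complex.I / 2 * E4sig t) τ -
      chazyU6 (fun t => (Real.pi : ℂ) * Complex.I / 2 * E4sig t) τ ^ 2 +
      8 * chazyU4 (fun t => (Real.pi : ℂ) * Complex.I / 2 * E4sig t) τ ^ 3 = 0) ∧
    (chazyU4 (fun t => (Real.pi : ℂ) * Complex.I * E2sig t) τ *
        chazyU8 (fun t => (Real.pi : ℂ) * Complex.I * E2sig t) τ -
      chazyU6 (fun t => (Real.pi : ℂ) * Complex.I * E2sig t) τ ^ 2 +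
      8 * chazyU4 (fun t => (Real.pi : ℂ) * Complex.I * E2sig t) τ ^ 3 = 0) := by
  constructor
  · exact chazy_one (fun z hz => by simp only [E4sig_eq z hz]) τ hτ
  · exact chazy_two (fun z hz => by simp only [E2sig_eq z hz]) τ hτ
end
end

section
/- The space of modular forms of weight 2 and trivial character for the congruence subgroup Γ₀(4) is spanned by θ₃⁴ and θ₄⁴: for every modular form f of weight 2 on Γ₀(4) there exist complex numbers a, b such that f(τ) = a·θ₃(τ)⁴ + b·θ₄(τ)⁴ for all τ in the upper half-plane. -/
open Complex

noncomputable section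

/-- The Jacobi theta-null θ₃. -/
def theta3 (τ : ℂ) : ℂ :=
  ∑' m : ℤ, Complex.exp (2 * Real.pi * Complex.I * τ * (m : ℂ) ^ 2)

/-- The Jacobi theta-null θ₄. -/
def theta4 (τ : ℂ) : ℂ :=
  ∑' m : ℤ, (-1 : ℂ) ^ m * Complex.exp (2 * Real.pi * Complex.I * τ * (m : ℂ) ^ 2)

section thetaGroup
open UpperHalfPlane hiding I
open ModularForm MatrixGroups Filter Topology ModularGroup

lemma slash_S_S (f : ℍ → ℂ) : (f ∣[(2:ℤ)] S) ∣[(2:ℤ)] S = f := by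
  rw [← SlashAction.slash_mul]
  have : S * S = -1 := by decide
  rw [this]
  ext z
  rw [ModularForm.SL_slash_apply]
  simp [UpperHalfPlane.denom]

lemma slash_S_inv (f : ℍ → ℂ) : f ∣[(2:ℤ)] S⁻¹ = f ∣[(2:ℤ)] S := by
  conv_lhs => rw [← slash_S_S f]
  rw [← SlashAction.slash_mul _ S S⁻¹]
  simp

/-- The relation used for the sixth-order action of `SL(2, ℤ)` on a form on the theta group. -/
lemma slash_TST {B : ℍ → ℂ} (hS : B ∣[(2:ℤ)] S = -B) (hT : (B ∣[(2:ℤ)] T) ∣[(2:ℤ)] T = B) :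
    ((B ∣[(2:ℤ)] T) ∣[(2:ℤ)] S) ∣[(2:ℤ)] T = -((B ∣[(2:ℤ)] T) ∣[(2:ℤ)] S) := by
  have hTi : B ∣[(2:ℤ)] T⁻¹ = B ∣[(2:ℤ)] T := by
    conv_lhs => rw [← hT]
    rw [← SlashAction.slash_mul _ T T⁻¹]
    simp
  have h : T * (S * T) = S * S * S * T⁻¹ * S := by decide
  rw [← SlashAction.slash_mul, ← SlashAction.slash_mul, h, SlashAction.slash_mul,
    SlashAction.slash_mul, SlashAction.slash_mul, SlashAction.slash_mul, slash_S_S, hS]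
  simp [hTi]

abbrev red2 : SL(2, ℤ) →* SL(2, ZMod 2) := Matrix.SpecialLinearGroup.map (Int.castRingHom (ZMod 2))

/-- The six-case description of the translates of a theta-group form. -/
def SixCases (B : ℍ → ℂ) (γ : SL(2, ℤ)) : Prop :=
  (red2 γ = 1 ∧ B ∣[(2:ℤ)] γ = B) ∨
  (red2 γ = red2 S ∧ B ∣[(2:ℤ)] γ = -B) ∨
  (red2 γ = red2 T ∧ B ∣[(2:ℤ)] γ = B ∣[(2:ℤ)] T) ∨
  (red2 γ = red2 (S * T) ∧ B ∣[(2:ℤ)] γ = -(B ∣[(2:ℤ)] T)) ∨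
  (red2 γ = red2 (T * S) ∧ B ∣[(2:ℤ)] γ = (B ∣[(2:ℤ)] T) ∣[(2:ℤ)] S) ∨
  (red2 γ = red2 (T * S * T) ∧ B ∣[(2:ℤ)] γ = -((B ∣[(2:ℤ)] T) ∣[(2:ℤ)] S))

lemma sixCases_S {B : ℍ → ℂ} (hS : B ∣[(2:ℤ)] S = -B) {γ : SL(2, ℤ)} (h : SixCases B γ) :
    SixCases B (γ * S) := by
  unfold SixCases at *
  rw [map_mul, SlashAction.slash_mul]
  rcases h with ⟨h1, h2⟩ | ⟨h1, h2⟩ | ⟨h1, h2⟩ | ⟨h1, h2⟩ | ⟨h1, h2⟩ | ⟨h1, h2⟩ <;> rw [h1, h2]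
  · exact .inr (.inl ⟨by decide, hS⟩)
  · exact .inl ⟨by decide, by simp [hS]⟩
  · exact .inr (.inr (.inr (.inr (.inl ⟨by decide, rfl⟩))))
  · exact .inr (.inr (.inr (.inr (.inr ⟨by decide, by simp⟩))))
  · exact .inr (.inr (.inl ⟨by decide, slash_S_S _⟩))
  · exact .inr (.inr (.inr (.inl ⟨by decide, by simp [slash_S_S]⟩)))

lemma sixCases_T {B : ℍ → ℂ} (hS : B ∣[(2:ℤ)] S = -B) (hT : (B ∣[(2:ℤ)] T) ∣[(2:ℤ)] T = B)
    {γ : SL(2, ℤ)} (h : SixCases B γ) : SixCases B (γ * T) := by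
  have hD := slash_TST hS hT
  unfold SixCases at *
  rw [map_mul, SlashAction.slash_mul]
  rcases h with ⟨h1, h2⟩ | ⟨h1, h2⟩ | ⟨h1, h2⟩ | ⟨h1, h2⟩ | ⟨h1, h2⟩ | ⟨h1, h2⟩ <;> rw [h1, h2]
  · exact .inr (.inr (.inl ⟨by decide, rfl⟩))
  · exact .inr (.inr (.inr (.inl ⟨by decide, by simp⟩)))
  · exact .inl ⟨by decide, hT⟩
  · exact .inr (.inl ⟨by decide, by simp [hT]⟩)
  · exact .inr (.inr (.inr (.inr (.inr ⟨by decide, hD⟩))))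
  · exact .inr (.inr (.inr (.inr (.inl ⟨by decide, by simp [hD]⟩))))

lemma sixCases {B : ℍ → ℂ} (hS : B ∣[(2:ℤ)] S = -B) (hT : (B ∣[(2:ℤ)] T) ∣[(2:ℤ)] T = B)
    (γ : SL(2, ℤ)) : SixCases B γ := by
  -- right multiplication by `T⁻¹` agrees with `T` as all the functions are `T ^ 2`-invariant
  have hTi {γ : SL(2, ℤ)} (h : SixCases B γ) : SixCases B (γ * T⁻¹) := by
    have hD := slash_TST hS hT
    have key : ((B ∣[(2:ℤ)] γ) ∣[(2:ℤ)] T) ∣[(2:ℤ)] T = B ∣[(2:ℤ)] γ := by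
      rcases h with ⟨h1, h2⟩ | ⟨h1, h2⟩ | ⟨h1, h2⟩ | ⟨h1, h2⟩ | ⟨h1, h2⟩ | ⟨h1, h2⟩ <;>
        rw [h2] <;> simp [hT, hD]
    have e1 : B ∣[(2:ℤ)] (γ * T⁻¹) = B ∣[(2:ℤ)] (γ * T) := by
      rw [SlashAction.slash_mul, ← key, ← SlashAction.slash_mul _ T T⁻¹]
      simp [SlashAction.slash_mul]
    have e2 : red2 (γ * T⁻¹) = red2 (γ * T) := by
      rw [map_mul, map_mul]; congr 1; decide
    have := sixCases_T hS hT h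
    unfold SixCases at *
    rwa [e1, e2]
  have hSi {γ : SL(2, ℤ)} (h : SixCases B γ) : SixCases B (γ * S⁻¹) := by
    have e1 : B ∣[(2:ℤ)] (γ * S⁻¹) = B ∣[(2:ℤ)] (γ * S) := by
      rw [SlashAction.slash_mul, slash_S_inv, SlashAction.slash_mul]
    have e2 : red2 (γ * S⁻¹) = red2 (γ * S) := by
      rw [map_mul, map_mul]; congr 1; decide
    have := sixCases_S hS h
    unfold SixCases at *
    rwa [e1, e2]
  have hγ : γ ∈ Subgroup.closure {S, T} := by simp [SpecialLinearGroup.SL2Z_generators]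
  induction hγ using Subgroup.closure_induction_right with
  | one => exact .inl ⟨by simp, by simp⟩
  | mul_right x hx y hy ih =>
    rcases hy with rfl | rfl
    · exact sixCases_S hS ih
    · exact sixCases_T hS hT ih
  | mul_inv_cancel x hx y hy ih =>
    rcases hy with rfl | rfl
    · exact hSi ih
    · exact hTi ih

lemma slash_Gamma_two {B : ℍ → ℂ} (hS : B ∣[(2:ℤ)] S = -B)
    (hT : (B ∣[(2:ℤ)] T) ∣[(2:ℤ)] T = B)
    (γ : SL(2, ℤ)) (hγ : γ ∈ CongruenceSubgroup.Gamma 2) : B ∣[(2:ℤ)] γ = B := by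
  have h0 : red2 γ = 1 := CongruenceSubgroup.Gamma_mem'.mp hγ
  have h := sixCases hS hT γ
  unfold SixCases at h
  rw [h0] at h
  rcases h with ⟨h1, h2⟩ | ⟨h1, h2⟩ | ⟨h1, h2⟩ | ⟨h1, h2⟩ | ⟨h1, h2⟩ | ⟨h1, h2⟩
  · exact h2
  all_goals exact absurd h1 (by decide)

/-- Package a theta-group form as a modular form on `Γ(2)`. -/
def mkGammaTwo (B : ℍ → ℂ) (hS : B ∣[(2:ℤ)] S = -B) (hT : (B ∣[(2:ℤ)] T) ∣[(2:ℤ)] T = B)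
    (hB : MDifferentiable (modelWithCornersSelf ℂ ℂ) (modelWithCornersSelf ℂ ℂ) B)
    (b1 : IsBoundedAtImInfty B) (b2 : IsBoundedAtImInfty (B ∣[(2:ℤ)] T))
    (b3 : IsBoundedAtImInfty ((B ∣[(2:ℤ)] T) ∣[(2:ℤ)] S)) :
    ModularForm (CongruenceSubgroup.Gamma 2) 2 where
  toFun := B
  slash_action_eq' := by
    rintro _ ⟨γ, hγ, rfl⟩
    exact slash_Gamma_two hS hT γ hγ
  holo' := hB
  bdd_at_cusps' {c} hc := by
    rw [Subgroup.IsArithmetic.isCusp_iff_isCusp_SL2Z] at hc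
    rw [OnePoint.isBoundedAt_iff_forall_SL2Z hc]
    intro γ _
    rcases sixCases hS hT γ with ⟨_, h2⟩ | ⟨_, h2⟩ | ⟨_, h2⟩ | ⟨_, h2⟩ | ⟨_, h2⟩ | ⟨_, h2⟩ <;>
      rw [h2]
    · exact b1
    · exact b1.neg
    · exact b2
    · exact b2.neg
    · exact b3
    · exact b3.neg

end thetaGroup
section thetaAnalysis
open UpperHalfPlane hiding I
open ModularForm MatrixGroups Filter Topology ModularGroup

/-- The fourth power of the Jacobi theta function. -/
def B4 (τ : ℍ) : ℂ := jacobiTheta (τ : ℂ) ^ 4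

lemma cpow_half_four (z : ℂ) : (z ^ (1 / 2 : ℂ)) ^ 4 = z ^ 2 := by
  rw [← Complex.cpow_nat_mul]
  norm_num

lemma B4_S : B4 ∣[(2:ℤ)] S = -B4 := by
  ext z
  rw [ModularForm.SL_slash_apply, denom_S, B4, jacobiTheta_S_smul, mul_pow, cpow_half_four]
  have hz : (z : ℂ) ≠ 0 := z.ne_zero
  simp only [Pi.neg_apply, B4, mul_pow, neg_sq, I_sq]
  have : (z : ℂ) ^ 2 * (z : ℂ) ^ (-2 : ℤ) = 1 := by
    rw [zpow_neg]; exact mul_inv_cancel₀ (by exact_mod_cast pow_ne_zero 2 hz)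
  linear_combination (-jacobiTheta ↑z ^ 4) * this

lemma denom_T_one (z : ℍ) : denom (T : GL (Fin 2) ℝ) z = 1 := by
  simp [denom, coe_T]

lemma B4_T_apply (z : ℍ) : (B4 ∣[(2:ℤ)] T) z = jacobiTheta ((z : ℂ) + 1) ^ 4 := by
  rw [ModularForm.SL_slash_apply, denom_T_one, B4, modular_T_smul]
  simp [add_comm]

lemma B4_TT : (B4 ∣[(2:ℤ)] T) ∣[(2:ℤ)] T = B4 := by
  ext z
  rw [ModularForm.SL_slash_apply, denom_T_one, B4_T_apply, modular_T_smul, B4]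
  have : ((((1 : ℝ) +ᵥ z : ℍ) : ℂ) + 1) = 2 + z := by
    simp; ring
  rw [this, jacobiTheta_two_add]
  simp

lemma jacobiTheta_add_one (τ : ℂ) : jacobiTheta (τ + 1) = jacobiTheta₂ (1 / 2) τ := by
  refine tsum_congr fun n => ?_
  rw [jacobiTheta₂_term]
  have : (Real.pi * I * (n : ℂ) ^ 2 * (τ + 1)) =
    (2 * Real.pi * I * n * (1 / 2) + Real.pi * I * (n : ℂ) ^ 2 * τ) +
      Real.pi * I * ((n * (n - 1) : ℤ) : ℂ) := by
    push_cast; ring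
  rw [this, Complex.exp_add]
  obtain ⟨m, hm⟩ : Even (n * (n - 1)) := Int.even_mul_pred_self n
  have h2 : Real.pi * I * ((n * (n - 1) : ℤ) : ℂ) = m * (2 * Real.pi * I) := by
    rw [hm]; push_cast; ring
  rw [h2, Complex.exp_int_mul_two_pi_mul_I, mul_one]

lemma B4_TS_apply (z : ℍ) : ((B4 ∣[(2:ℤ)] T) ∣[(2:ℤ)] S) z =
    -(Complex.exp (Real.pi * I * z) * jacobiTheta₂ (z / 2) z ^ 4) := by
  have hz : (z : ℂ) ≠ 0 := z.ne_zero
  rw [ModularForm.SL_slash_apply, denom_S, B4_T_apply, jacobiTheta_add_one]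
  have e : ((S • z : ℍ) : ℂ) = -1 / (z : ℂ) := by
    rw [modular_S_smul]; simp [neg_div]
  have h0 : (-I * (z : ℂ)) ≠ 0 := mul_ne_zero (neg_ne_zero.mpr I_ne_zero) hz
  rw [e, jacobiTheta₂_functional_equation (z / 2) z]
  have e2 : (z : ℂ) / 2 / z = 1 / 2 := by field_simp
  have h4 : (1 / (-I * (z : ℂ)) ^ (1 / 2 : ℂ)) ^ 4 = -1 / (z : ℂ) ^ 2 := by
    rw [div_pow, cpow_half_four, mul_pow, neg_sq, I_sq]
    field_simp
  have h5 : Complex.exp (-Real.pi * I * (z / 2 : ℂ) ^ 2 / z) ^ 4 = Complex.exp (-(Real.pi * I * z)) := by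
    rw [← Complex.exp_nat_mul]
    congr 1
    field_simp
    norm_num
  rw [e2, mul_pow, mul_pow, h4, h5, Complex.exp_neg]
  have := Complex.exp_ne_zero (Real.pi * I * z)
  rw [zpow_neg]
  have h6 : (z : ℂ) ^ (2 : ℤ) = (z : ℂ) ^ 2 := by norm_cast
  rw [h6]
  field_simp

lemma tendsto_B4 : Tendsto B4 atImInfty (𝓝 1) := by
  have h : Tendsto (fun τ : ℂ => jacobiTheta τ - 1) (comap Complex.im atTop) (𝓝 0) := by
    refine isBigO_at_im_infty_jacobiTheta_sub_one.trans_tendsto ?_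
    have : Tendsto (fun y : ℝ => Real.exp (-Real.pi * y)) atTop (𝓝 0) :=
      Real.tendsto_exp_atBot.comp ((tendsto_const_mul_atBot_of_neg (by simp [Real.pi_pos])).mpr tendsto_id)
    exact this.comp tendsto_comap
  have h2 : Tendsto (fun τ : ℂ => jacobiTheta τ) (comap Complex.im atTop) (𝓝 1) := by
    simpa using h.add_const 1
  simpa [B4, Function.comp_def] using! (h2.comp tendsto_coe_atImInfty).pow 4

lemma tendsto_B4_T : Tendsto (B4 ∣[(2:ℤ)] T) atImInfty (𝓝 1) := by
  have h : B4 ∣[(2:ℤ)] T = B4 ∘ (fun z => (T : GL (Fin 2) ℝ) • z) := by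
    ext z
    rw [ModularForm.SL_slash_apply, denom_T_one]
    simp
  rw [h]
  exact tendsto_B4.comp (tendsto_smul_atImInfty (by simp [coe_T]))

lemma norm_theta2_le : ∃ K : ℝ, ∀ z : ℍ, 1 ≤ z.im → ‖jacobiTheta₂ ((z : ℂ) / 2) z‖ ≤ K := by
  have hs := ((summable_jacobiTheta₂_term_iff (I / 2) I).mpr (by simp)).norm
  refine ⟨∑' n, ‖jacobiTheta₂_term n (I / 2) I‖, fun z hz => ?_⟩
  refine tsum_of_norm_bounded hs.hasSum fun n => ?_
  rw [norm_jacobiTheta₂_term, norm_jacobiTheta₂_term, Real.exp_le_exp]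
  have e1 : ((z : ℂ) / 2).im = z.im / 2 := by simp
  have e2 : (I / 2 : ℂ).im = 1 / 2 := by simp
  rw [e1, e2, coe_im, Complex.I_im]
  have hn : (0 : ℝ) ≤ (n : ℝ) ^ 2 + n := by
    have : (0 : ℤ) ≤ n ^ 2 + n := by nlinarith [Int.le_self_sq (-n)]
    exact_mod_cast this
  nlinarith [mul_nonneg (mul_nonneg Real.pi_pos.le hn) (sub_nonneg.mpr hz)]

lemma tendsto_B4_TS : Tendsto ((B4 ∣[(2:ℤ)] T) ∣[(2:ℤ)] S) atImInfty (𝓝 0) := by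
  obtain ⟨K, hK⟩ := norm_theta2_le
  have h1 : Tendsto (fun z : ℍ => Real.exp (-Real.pi * z.im) * K ^ 4) atImInfty (𝓝 0) := by
    have : Tendsto (fun y : ℝ => Real.exp (-Real.pi * y)) atTop (𝓝 0) :=
      Real.tendsto_exp_atBot.comp ((tendsto_const_mul_atBot_of_neg (by simp [Real.pi_pos])).mpr tendsto_id)
    simpa using! (this.comp (tendsto_comap (f := UpperHalfPlane.im))).mul_const (K ^ 4)
  refine squeeze_zero_norm' ?_ h1
  have : ∀ᶠ z : ℍ in atImInfty, 1 ≤ z.im := tendsto_comap.eventually (eventually_ge_atTop 1)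
  filter_upwards [this] with z hz
  rw [B4_TS_apply, norm_neg, norm_mul, norm_pow]
  have e : ‖Complex.exp (Real.pi * I * z)‖ = Real.exp (-Real.pi * z.im) := by
    rw [Complex.norm_exp]; simp
  rw [e]
  gcongr
  exact hK z hz

lemma isBounded_of_tendsto {f : ℍ → ℂ} {c : ℂ} (h : Tendsto f atImInfty (𝓝 c)) :
    IsBoundedAtImInfty f := h.isBigO_one ℝ

lemma mdiff_B4 : MDifferentiable (modelWithCornersSelf ℂ ℂ) (modelWithCornersSelf ℂ ℂ) B4 :=
  mdifferentiable_jacobiTheta.pow 4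

/-- `θ⁴` as a modular form on `Γ(2)`. -/
def B4form : ModularForm (CongruenceSubgroup.Gamma 2) 2 :=
  mkGammaTwo B4 B4_S B4_TT mdiff_B4 (isBounded_of_tendsto tendsto_B4)
    (isBounded_of_tendsto tendsto_B4_T) (isBounded_of_tendsto tendsto_B4_TS)

lemma coe_B4form : (B4form : ℍ → ℂ) = B4 := rfl

end thetaAnalysis
section vanishing
open UpperHalfPlane hiding I
open ModularForm MatrixGroups Filter Topology ModularGroup CongruenceSubgroup Matrix.SpecialLinearGroup

/-- The translate of a form on `Γ(2)` by an element of `SL(2, ℤ)`, again on `Γ(2)`. -/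
def trans2 (g : ModularForm (Gamma 2) 2) (w : SL(2, ℤ)) : ModularForm (Gamma 2) 2 where
  toFun := (g : ℍ → ℂ) ∣[(2:ℤ)] w
  slash_action_eq' := by
    rintro _ ⟨γ, hγ, rfl⟩
    change ((g : ℍ → ℂ) ∣[(2:ℤ)] w) ∣[(2:ℤ)] γ = _
    have h : w * γ * w⁻¹ ∈ CongruenceSubgroup.Gamma 2 := (Gamma_normal 2).conj_mem γ hγ w
    have h2 : (g : ℍ → ℂ) ∣[(2:ℤ)] (w * γ * w⁻¹) = g :=
      g.slash_action_eq' _ ⟨_, h, rfl⟩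
    conv_rhs => rw [← h2]
    rw [← SlashAction.slash_mul, ← SlashAction.slash_mul]
    simp
  holo' := g.holo'.slash 2 _
  bdd_at_cusps' {c} hc := by
    rw [Subgroup.IsArithmetic.isCusp_iff_isCusp_SL2Z] at hc
    rw [OnePoint.isBoundedAt_iff_forall_SL2Z hc]
    intro γ _
    rw [← SlashAction.slash_mul]
    have hc2 : IsCusp (mapGL ℝ (w * γ) • (OnePoint.infty : OnePoint ℝ)) 𝒮ℒ :=
      isCusp_SL2Z_iff'.mpr ⟨_, rfl⟩
    have hc3 := hc2
    rw [← Subgroup.IsArithmetic.isCusp_iff_isCusp_SL2Z (Gamma 2 : Subgroup (GL (Fin 2) ℝ))] at hc3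
    exact (OnePoint.isBoundedAt_iff_forall_SL2Z hc2).mp (g.bdd_at_cusps' hc3) _ rfl

lemma coe_trans2 (g : ModularForm (Gamma 2) 2) (w : SL(2, ℤ)) :
    (trans2 g w : ℍ → ℂ) = (g : ℍ → ℂ) ∣[(2:ℤ)] w := rfl

lemma two_mem_periods :
    (2 : ℝ) ∈ (Gamma 2 : Subgroup (GL (Fin 2) ℝ)).strictPeriods := by
  rw [CongruenceSubgroup.strictPeriods_Gamma]
  simp

lemma periodic2 (g : ModularForm (Gamma 2) 2) :
    Function.Periodic ((g : ℍ → ℂ) ∘ ofComplex) (2 : ℝ) :=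
  SlashInvariantFormClass.periodic_comp_ofComplex g two_mem_periods

lemma bdd2 (g : ModularForm (Gamma 2) 2) : IsBoundedAtImInfty g :=
  OnePoint.isBoundedAt_infty_iff.mp
    (g.bdd_at_cusps' (Subgroup.isCusp_of_mem_strictPeriods two_pos two_mem_periods))

lemma decay2 (g : ModularForm (Gamma 2) 2) (hg : IsZeroAtImInfty g) :
    (g : ℍ → ℂ) =O[atImInfty] fun τ ↦ Real.exp (-Real.pi * τ.im) := by
  have := hg.exp_decay_atImInfty two_pos (periodic2 g) g.holo' (bdd2 g)
  refine this.congr_right fun τ => ?_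
  congr 1; ring

lemma tendsto2 (g : ModularForm (Gamma 2) 2) : ∃ c : ℂ, Tendsto g atImInfty (𝓝 c) := by
  refine ⟨valueAtInfty g, ?_⟩
  have h := exp_decay_sub_atImInfty (h := 2) two_pos (periodic2 g) g.holo' (bdd2 g)
  have h1 : Tendsto (fun z : ℍ => Real.exp (-2 * Real.pi * z.im / 2)) atImInfty (𝓝 0) := by
    have : Tendsto (fun y : ℝ => Real.exp (-Real.pi * y)) atTop (𝓝 0) :=
      Real.tendsto_exp_atBot.comp ((tendsto_const_mul_atBot_of_neg (by simp [Real.pi_pos])).mpr tendsto_id)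
    refine (this.comp (tendsto_comap (f := UpperHalfPlane.im))).congr fun z => ?_
    simp only [Function.comp_apply]
    congr 1; ring
  simpa using (h.trans_tendsto h1).add_const (valueAtInfty g)

/-- Four coset representatives seeing the cusps `∞` and `0`. -/
def wrep : Fin 4 → SL(2, ℤ) := ![1, T, S, S * T]

lemma wrep_inj : Function.Injective (fun i => red2 (wrep i)) := by decide

lemma zero_wrep (g : ModularForm (Gamma 2) 2) (h1 : IsZeroAtImInfty g)
    (h2 : IsZeroAtImInfty ((g : ℍ → ℂ) ∣[(2:ℤ)] S)) (i : Fin 4) :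
    IsZeroAtImInfty ((g : ℍ → ℂ) ∣[(2:ℤ)] wrep i) := by
  have hT : ((T : GL (Fin 2) ℝ)) 1 0 = 0 := by simp [coe_T]
  fin_cases i
  · simpa [wrep] using h1
  · exact h1.slash 2 hT
  · exact h2
  · change IsZeroAtImInfty ((g : ℍ → ℂ) ∣[(2:ℤ)] (S * T))
    rw [SlashAction.slash_mul]
    exact h2.slash 2 hT

lemma card_le : Nat.card (𝒮ℒ ⧸ ((Gamma 2 : Subgroup (GL (Fin 2) ℝ)).subgroupOf 𝒮ℒ)) ≤ 6 := by
  change (Gamma 2 : Subgroup (GL (Fin 2) ℝ)).relIndex 𝒮ℒ ≤ 6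
  have h : (𝒮ℒ : Subgroup (GL (Fin 2) ℝ)) = (⊤ : Subgroup SL(2, ℤ)).map (mapGL ℝ) :=
    MonoidHom.range_eq_map _
  rw [h, Subgroup.relIndex_map_map_of_injective _ _ mapGL_injective, Subgroup.relIndex_top_right]
  have h6 : Nat.card SL(2, ZMod 2) = 6 := by
    rw [Nat.card_eq_fintype_card]; decide
  change red2.ker.index ≤ 6
  rw [Subgroup.index_ker, ← h6]
  exact Subgroup.card_le_card_group _

/-- Level one: decay of order two in small weight forces vanishing. -/
lemma levelOne_zero_s11 {k : ℤ} (hk : k ≤ 12) (f : ModularForm 𝒮ℒ k)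
    (hf : (f : ℍ → ℂ) =O[atImInfty] fun τ ↦ Real.exp (-4 * Real.pi * τ.im)) : f = 0 := by
  apply ModularForm.sturm_bound_levelOne
  have hco : ∀ n : ℕ, n < 2 → (qExpansion 1 f).coeff n = 0 := by
    intro n hn
    obtain ⟨C, hC0, hC⟩ := hf.exists_nonneg
    obtain ⟨A, hA⟩ := (UpperHalfPlane.atImInfty_mem _).mp hC.bound
    have hb : ∀ t : ℝ, max A 1 ≤ t →
        ‖(qExpansion 1 f).coeff n‖ ≤ C * Real.exp (-2 * Real.pi * t) := by
      intro t ht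
      have ht0 : 0 < t := lt_of_lt_of_le one_pos ((le_max_right _ _).trans ht)
      rw [ModularFormClass.qExpansion_coeff_eq_intervalIntegral f one_pos one_mem_strictPeriods_SL n ht0]
      simp only [ofReal_one, div_one, one_mul]
      refine (intervalIntegral.norm_integral_le_of_norm_le_const
        (C := C * Real.exp (-2 * Real.pi * t)) fun u hu => ?_).trans (by simp)
      have h3 := hA ⟨u + t * Complex.I, by simpa using ht0⟩
        (by simpa [UpperHalfPlane.im] using (le_max_left _ _).trans ht)
      simp only [Set.mem_ofPred_eq, Real.norm_eq_abs, Real.abs_exp] at h3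
      have h4 : (⟨u + t * Complex.I, by simpa using ht0⟩ : ℍ).im = t := by simp [UpperHalfPlane.im]
      rw [h4] at h3
      rw [norm_mul, norm_div, norm_pow, norm_one, Function.Periodic.norm_qParam]
      have h5 : (↑u + ↑t * Complex.I).im = t := by simp
      rw [h5, div_one, ← Real.exp_nat_mul, one_div, ← Real.exp_neg]
      refine (mul_le_mul_of_nonneg_left h3 (Real.exp_pos _).le).trans ?_
      rw [mul_left_comm, ← Real.exp_add]
      refine mul_le_mul_of_nonneg_left (Real.exp_le_exp.mpr ?_) hC0
      have h6 : (n : ℝ) ≤ 1 := by exact_mod_cast Nat.lt_succ_iff.mp hn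
      nlinarith [mul_le_mul_of_nonneg_right h6 (mul_pos Real.pi_pos ht0).le]
    have hlim : Tendsto (fun t : ℝ => C * Real.exp (-2 * Real.pi * t)) atTop (𝓝 (C * 0)) := by
      refine Tendsto.const_mul C (Real.tendsto_exp_atBot.comp
        ((tendsto_const_mul_atBot_of_neg ?_).mpr tendsto_id))
      have := Real.pi_pos
      linarith
    rw [mul_zero] at hlim
    have := ge_of_tendsto hlim ((eventually_ge_atTop (max A 1)).mono hb)
    simpa using this
  have h2 : ((2 : ℕ) : ℕ∞) ≤ (qExpansion 1 f).order :=
    PowerSeries.le_order _ _ fun i hi => hco i (by exact_mod_cast hi)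
  refine lt_of_lt_of_le ?_ h2
  have : k.toNat / 12 < 2 := by omega
  exact_mod_cast this

lemma eq_zero2 (g : ModularForm (Gamma 2) 2) (h1 : IsZeroAtImInfty g)
    (h2 : IsZeroAtImInfty ((g : ℍ → ℂ) ∣[(2:ℤ)] S)) : (g : ℍ → ℂ) = 0 := by
  rw [← ModularForm.norm_eq_zero_iff 𝒮ℒ g]
  apply levelOne_zero_s11
  · have := card_le
    omega
  · rw [ModularForm.coe_norm]
    classical
    let _ : Fintype (𝒮ℒ ⧸ ((Gamma 2 : Subgroup (GL (Fin 2) ℝ)).subgroupOf 𝒮ℒ)) := Fintype.ofFinite _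
    let q : Fin 4 → 𝒮ℒ ⧸ ((Gamma 2 : Subgroup (GL (Fin 2) ℝ)).subgroupOf 𝒮ℒ) :=
      fun i => ⟦⟨mapGL ℝ (wrep i)⁻¹, ⟨_, rfl⟩⟩⟧
    have hq : Function.Injective q := by
      intro i j hij
      apply wrep_inj
      have h3 := QuotientGroup.eq.mp hij
      rw [Subgroup.mem_subgroupOf] at h3
      obtain ⟨γ, hγ, h4⟩ := h3
      have h5 : γ = wrep i * (wrep j)⁻¹ := by
        apply mapGL_injective (S := ℝ)
        rw [h4]
        simp
      have h6 : red2 γ = 1 := hγ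
      rw [h5, map_mul, map_inv, mul_inv_eq_one] at h6
      exact h6
    have hqf (w : SL(2, ℤ)) : SlashInvariantForm.quotientFunc g
        (⟦⟨mapGL ℝ w⁻¹, ⟨_, rfl⟩⟩⟧ : 𝒮ℒ ⧸ ((Gamma 2 : Subgroup (GL (Fin 2) ℝ)).subgroupOf 𝒮ℒ))
        = trans2 g w := by
      rw [SlashInvariantForm.quotientFunc_mk, coe_trans2]
      simp
      rfl
    have hb (x : 𝒮ℒ ⧸ ((Gamma 2 : Subgroup (GL (Fin 2) ℝ)).subgroupOf 𝒮ℒ)) :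
        SlashInvariantForm.quotientFunc g x =O[atImInfty] (fun _ => (1 : ℝ)) := by
      induction x using Quotient.inductionOn with
      | h r =>
        obtain ⟨_, ⟨w, rfl⟩⟩ := r
        have := hqf w⁻¹
        simp only [inv_inv] at this
        rw [this]
        exact bdd2 _
    have hd (i : Fin 4) : SlashInvariantForm.quotientFunc g (q i)
        =O[atImInfty] (fun τ => Real.exp (-Real.pi * τ.im)) := by
      rw [hqf]
      exact decay2 _ (zero_wrep g h1 h2 i)
    have e : (∏ x : 𝒮ℒ ⧸ ((Gamma 2 : Subgroup (GL (Fin 2) ℝ)).subgroupOf 𝒮ℒ), SlashInvariantForm.quotientFunc g x) =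
        fun τ => (∏ i, SlashInvariantForm.quotientFunc g (q i) τ) *
          ∏ x ∈ (Finset.univ.image q)ᶜ, SlashInvariantForm.quotientFunc g x τ := by
      ext τ
      rw [Finset.prod_apply, ← Finset.prod_mul_prod_compl (Finset.univ.image q),
        Finset.prod_image hq.injOn]
    change (∏ x : 𝒮ℒ ⧸ ((Gamma 2 : Subgroup (GL (Fin 2) ℝ)).subgroupOf 𝒮ℒ), SlashInvariantForm.quotientFunc g x) =O[atImInfty] _
    rw [e]
    have i1 := Asymptotics.IsBigO.finsetProd (s := (Finset.univ : Finset (Fin 4))) (fun i _ => hd i)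
    have i2 := Asymptotics.IsBigO.finsetProd (s := (Finset.univ.image q)ᶜ) (fun i _ => hb i)
    refine (i1.mul i2).congr_right fun τ => ?_
    simp only [Finset.prod_const, Finset.card_univ, Fintype.card_fin, one_pow, mul_one]
    rw [← Real.exp_nat_mul]
    congr 1; push_cast; ring

end vanishing
section conclusion
open UpperHalfPlane hiding I
open ModularForm MatrixGroups Filter Topology ModularGroup Matrix.SpecialLinearGroup

/-- The matrix `diag(1, 2)`. -/
def dmat : GL (Fin 2) ℝ := Matrix.GeneralLinearGroup.mkOfDetNeZero !![1, 0; 0, 2] (by simp)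

lemma coe_dmat : (dmat : Matrix (Fin 2) (Fin 2) ℝ) = !![1, 0; 0, 2] := rfl

lemma dmat_conj {γ : SL(2, ℤ)} (hγ : γ ∈ CongruenceSubgroup.Gamma 2) :
    ∃ δ ∈ CongruenceSubgroup.Gamma0 4, dmat * mapGL ℝ γ = mapGL ℝ δ * dmat := by
  rw [CongruenceSubgroup.Gamma_mem] at hγ
  obtain ⟨-, hb, hc, -⟩ := hγ
  obtain ⟨b, hb⟩ := (ZMod.intCast_zmod_eq_zero_iff_dvd _ 2).mp hb
  obtain ⟨c, hc⟩ := (ZMod.intCast_zmod_eq_zero_iff_dvd _ 2).mp hc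
  have hdet := γ.det_coe
  rw [Matrix.det_fin_two] at hdet
  push_cast at hb hc
  obtain ⟨δ, e⟩ : ∃ δ : SL(2, ℤ), (δ : Matrix (Fin 2) (Fin 2) ℤ) =
      !![γ 0 0, b; 4 * c, γ 1 1] := by
    refine ⟨⟨!![γ 0 0, b; 4 * c, γ 1 1], ?_⟩, rfl⟩
    rw [Matrix.det_fin_two_of]
    rw [hb, hc] at hdet
    linarith
  have e00 : δ 0 0 = γ 0 0 := by rw [e]; rfl
  have e01 : δ 0 1 = b := by rw [e]; rfl
  have e10 : δ 1 0 = 4 * c := by rw [e]; rfl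
  have e11 : δ 1 1 = γ 1 1 := by rw [e]; rfl
  refine ⟨δ, ?_, ?_⟩
  · rw [CongruenceSubgroup.Gamma0_mem, e10, ZMod.intCast_zmod_eq_zero_iff_dvd]
    exact ⟨c, by norm_num⟩
  · ext i j
    fin_cases i <;> fin_cases j <;>
      simp [coe_dmat, Matrix.mul_apply, Fin.sum_univ_two, hb, hc, e00, e01, e10, e11] <;> ring

lemma dmat_mem {γ : SL(2, ℤ)} (hγ : γ ∈ CongruenceSubgroup.Gamma 2) :
    dmat * mapGL ℝ γ * dmat⁻¹ ∈
      (CongruenceSubgroup.Gamma0 4 : Subgroup (GL (Fin 2) ℝ)) := by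
  obtain ⟨δ, h, e⟩ := dmat_conj hγ
  exact ⟨δ, h, by rw [e]; simp⟩

/-- The form `τ ↦ f (τ / 2) / 2` on `Γ(2)`. -/
def half (f : ModularForm (CongruenceSubgroup.Gamma0 4) 2) :
    ModularForm (CongruenceSubgroup.Gamma 2) 2 where
  toFun := (f : ℍ → ℂ) ∣[(2:ℤ)] dmat
  slash_action_eq' := by
    rintro _ ⟨γ, hγ, rfl⟩
    have h2 : (f : ℍ → ℂ) ∣[(2:ℤ)] (dmat * mapGL ℝ γ * dmat⁻¹) = f :=
      f.slash_action_eq' _ (dmat_mem hγ)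
    conv_rhs => rw [← h2]
    rw [← SlashAction.slash_mul, ← SlashAction.slash_mul]
    simp
  holo' := f.holo'.slash 2 _
  bdd_at_cusps' {c} hc := by
    rw [← OnePoint.IsBoundedAt.smul_iff]
    apply f.bdd_at_cusps'
    refine IsCusp.mono ?_ (hc.smul dmat)
    rintro x hx
    obtain ⟨y, ⟨γ, hγ, rfl⟩, rfl⟩ := hx
    exact dmat_mem hγ

lemma half_apply (f : ModularForm (CongruenceSubgroup.Gamma0 4) 2) (τ z : ℍ)
    (h : (z : ℂ) = 2 * τ) : half f z = f τ / 2 := by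
  change ((f : ℍ → ℂ) ∣[(2:ℤ)] dmat) z = _
  have hdet : dmat.det.val = 2 := by
    rw [Matrix.GeneralLinearGroup.val_det_apply, coe_dmat, Matrix.det_fin_two_of]; norm_num
  rw [ModularForm.slash_apply]
  have h1 : dmat • z = τ := by
    ext
    rw [coe_smul_of_det_pos (by rw [hdet]; norm_num)]
    simp [num, denom, coe_dmat, h]
  have h2 : denom dmat z = 2 := by simp [denom, coe_dmat]
  have h3 : σ dmat = ContinuousAlgEquiv.refl ℝ ℂ := by
    simp [σ, hdet]
  rw [h1, h2, h3, hdet]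
  norm_num
  ring

lemma theta3_eq (τ : ℂ) : theta3 τ = jacobiTheta (2 * τ) := by
  refine tsum_congr fun n => ?_
  congr 1; ring

lemma theta4_eq (τ : ℂ) : theta4 τ = jacobiTheta (2 * τ + 1) := by
  rw [jacobiTheta_add_one]
  refine tsum_congr fun n => ?_
  rw [jacobiTheta₂_term, Complex.exp_add]
  have : 2 * Real.pi * I * n * (1 / 2) = n * (Real.pi * I) := by ring
  rw [this, Complex.exp_int_mul, Complex.exp_pi_mul_I]
  congr 2; ring

lemma half_eq (h : ModularForm (CongruenceSubgroup.Gamma 2) 2) :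
    ∃ a b : ℂ, ∀ z : ℍ, h z = a * B4 z + b * (B4 ∣[(2:ℤ)] T) z := by
  obtain ⟨c1, h1⟩ := tendsto2 h
  obtain ⟨c2, h2⟩ := tendsto2 (trans2 h S)
  rw [coe_trans2] at h2
  refine ⟨-c2, c1 + c2, ?_⟩
  let g : ModularForm (CongruenceSubgroup.Gamma 2) 2 :=
    h - ((-c2) • B4form + (c1 + c2) • trans2 B4form T)
  have hg : (g : ℍ → ℂ) = (h : ℍ → ℂ) - ((-c2) • B4 + (c1 + c2) • (B4 ∣[(2:ℤ)] T)) := rfl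
  have e1 : Tendsto g atImInfty (𝓝 0) := by
    rw [hg]
    have := h1.sub ((tendsto_B4.const_smul (-c2)).add (tendsto_B4_T.const_smul (c1 + c2)))
    simpa using! this
  have e2 : Tendsto ((g : ℍ → ℂ) ∣[(2:ℤ)] S) atImInfty (𝓝 0) := by
    rw [hg, sub_eq_add_neg, SlashAction.add_slash, SlashAction.neg_slash, SlashAction.add_slash,
      ModularForm.SL_smul_slash, ModularForm.SL_smul_slash, B4_S]
    have := h2.add ((tendsto_B4.neg.const_smul (-c2)).add
      (tendsto_B4_TS.const_smul (c1 + c2))).neg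
    simpa using! this
  have h0 := eq_zero2 g e1 e2
  intro z
  have := congrFun h0 z
  rw [hg] at this
  simpa [sub_eq_zero] using this

end conclusion

theorem weight_two_level_four_spanned_by_theta_fourth_powers
    (f : ModularForm (CongruenceSubgroup.Gamma0 4) 2) :
    ∃ a b : ℂ, ∀ τ : UpperHalfPlane,
      f τ = a * theta3 (τ : ℂ) ^ 4 + b * theta4 (τ : ℂ) ^ 4 := by
  obtain ⟨a, b, h⟩ := half_eq (half f)
  refine ⟨2 * a, 2 * b, fun τ => ?_⟩
  have hz : 0 < (2 * (τ : ℂ)).im := by simpa using τ.im_pos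
  have h1 := h ⟨2 * τ, hz⟩
  rw [half_apply f τ _ rfl, B4_T_apply] at h1
  rw [theta3_eq, theta4_eq]
  change f τ / 2 = a * jacobiTheta (2 * τ) ^ 4 + b * jacobiTheta (2 * τ + 1) ^ 4 at h1
  linear_combination 2 * h1
end
end
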